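/- arXiv:1704.08128 — 3 statements merged into one kernel-verified Lean document; each statement's English description precedes it below -/
import Mathlib

section
/- Assume U and g are real-analytic, and let (q₀, p₀) ∈ ℝ^m × ℝ^m satisfy: ∇g(q₀)ᵀM⁻¹∇g(q₀) is nonsingular, g(q₀) = 0, and ∇g(q₀)ᵀM⁻¹p₀ = 0. Then there exist h₀ > 0 and r > 0 such that for every h ∈ (0, h₀] there is a unique λ₀ ∈ ℝ^ν with ‖λ₀ − λ(q₀,p₀)‖ ≤ r having the property that the solution (u, v) of the local problem u̇ = M⁻¹v, v̇ = −∇U(u) − ∇g(u)λ₀, u(0) = q₀, v(0) = p₀ exists on [0,h] and satisfies g(u(h)) = 0; moreover, for this λ₀ the endpoint values q₁ := u(h), p₁ := v(h) satisfy H(q₁, p₁) = H(q₀, p₀). -/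
open MeasureTheory Matrix Set

noncomputable def grad {m : ℕ} (f : (Fin m → ℝ) → ℝ) (q : Fin m → ℝ) : Fin m → ℝ :=
  fun i => fderiv ℝ f q (Pi.single i 1)

noncomputable def gradMat {m ν : ℕ} (g : (Fin m → ℝ) → (Fin ν → ℝ)) (q : Fin m → ℝ) :
    Matrix (Fin m) (Fin ν) ℝ :=
  Matrix.of fun i a => fderiv ℝ (fun x => g x a) q (Pi.single i 1)

noncomputable def hessVec {m ν : ℕ} (g : (Fin m → ℝ) → (Fin ν → ℝ)) (q v w : Fin m → ℝ) :
    Fin ν → ℝ :=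
  fun a => fderiv ℝ (fun x => fderiv ℝ (fun y => g y a) x w) q v

noncomputable def lagMult {m ν : ℕ} (M : Matrix (Fin m) (Fin m) ℝ)
    (U : (Fin m → ℝ) → ℝ) (g : (Fin m → ℝ) → (Fin ν → ℝ)) (q p : Fin m → ℝ) : Fin ν → ℝ :=
  ((gradMat g q)ᵀ * M⁻¹ * gradMat g q)⁻¹ *ᵥ
    (hessVec g q (M⁻¹ *ᵥ p) (M⁻¹ *ᵥ p) - (gradMat g q)ᵀ *ᵥ (M⁻¹ *ᵥ grad U q))

noncomputable def Ham {m : ℕ} (M : Matrix (Fin m) (Fin m) ℝ)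
    (U : (Fin m → ℝ) → ℝ) (q p : Fin m → ℝ) : ℝ :=
  (1 / 2) * (p ⬝ᵥ (M⁻¹ *ᵥ p)) + U q

noncomputable def HamHat {m ν : ℕ} (M : Matrix (Fin m) (Fin m) ℝ)
    (U : (Fin m → ℝ) → ℝ) (g : (Fin m → ℝ) → (Fin ν → ℝ))
    (q p : Fin m → ℝ) (lam : Fin ν → ℝ) : ℝ :=
  Ham M U q p + lam ⬝ᵥ g q

noncomputable def shiftedLegendre (j : ℕ) (x : ℝ) : ℝ :=
  (Real.sqrt (2 * j + 1) / (Nat.factorial j)) * iteratedDeriv j (fun y => (y ^ 2 - y) ^ j) x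


theorem aux_unique {E : Type*} [NormedAddCommGroup E] [NormedSpace ℝ E] [FiniteDimensional ℝ E]
    (F : E → E) (hF : ContDiff ℝ 1 F) (h : ℝ) (x y : ℝ → E)
    (hx : ∀ t ∈ Icc (0:ℝ) h, HasDerivAt x (F (x t)) t)
    (hy : ∀ t ∈ Icc (0:ℝ) h, HasDerivAt y (F (y t)) t)
    (h0 : x 0 = y 0) : EqOn x y (Icc 0 h) := by
  have cx : ContinuousOn x (Icc 0 h) := fun t ht => (hx t ht).continuousAt.continuousWithinAt
  have cy : ContinuousOn y (Icc 0 h) := fun t ht => (hy t ht).continuousAt.continuousWithinAt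
  have hc : IsCompact (x '' Icc 0 h ∪ y '' Icc 0 h) :=
    (isCompact_Icc.image_of_continuousOn cx).union (isCompact_Icc.image_of_continuousOn cy)
  obtain ⟨R, hR⟩ := hc.isBounded.subset_closedBall (0:E)
  obtain ⟨K, hK⟩ := (hF.contDiffOn (s := Metric.closedBall (0:E) R)).exists_lipschitzOnWith
    one_ne_zero (convex_closedBall _ _) (isCompact_closedBall _ _)
  refine ODE_solution_unique_of_mem_Icc_right (v := fun _ => F) (K := K)
    (s := fun _ => Metric.closedBall (0:E) R)
    (fun _ _ => hK) cx (fun t ht => (hx t (Ico_subset_Icc_self ht)).hasDerivWithinAt)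
    (fun t ht => hR (Or.inl ⟨t, Ico_subset_Icc_self ht, rfl⟩)) cy
    (fun t ht => (hy t (Ico_subset_Icc_self ht)).hasDerivWithinAt)
    (fun t ht => hR (Or.inr ⟨t, Ico_subset_Icc_self ht, rfl⟩)) h0

theorem aux_mv {E : Type*} [NormedAddCommGroup E] [NormedSpace ℝ E]
    (x x' : ℝ → E) (T C : ℝ) (hx : ∀ t ∈ Icc (0:ℝ) T, HasDerivAt x (x' t) t)
    (hC : ∀ t ∈ Icc (0:ℝ) T, ‖x' t‖ ≤ C) (t : ℝ) (ht : t ∈ Icc (0:ℝ) T) :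
    ‖x t - x 0‖ ≤ C * t := by
  simpa using norm_image_sub_le_of_norm_deriv_le_segment' (f := x) (f' := x') (a := 0) (b := T)
    (C := C) (fun s hs => (hx s hs).hasDerivWithinAt)
    (fun s hs => hC s (Ico_subset_Icc_self hs)) t ht

theorem aux_flow {E P : Type*} [NormedAddCommGroup E] [NormedSpace ℝ E] [FiniteDimensional ℝ E]
    [NormedAddCommGroup P] [NormedSpace ℝ P] [FiniteDimensional ℝ P]
    (F : E × P → E) (hF : ContDiff ℝ 1 F) (z₀ : E) (l₀ : P) :
    ∃ r > (0:ℝ), ∃ T > (0:ℝ), ∃ D ≥ (0:ℝ), ∃ R ≥ (0:ℝ), ∃ ζ : P → ℝ → E,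
      (∀ l ∈ Metric.closedBall l₀ r, ζ l 0 = z₀ ∧
        ∀ t ∈ Icc (0:ℝ) T, HasDerivAt (ζ l) (F (ζ l t, l)) t ∧ ‖ζ l t - z₀‖ ≤ D * t
          ∧ ‖ζ l t - z₀‖ ≤ R) ∧
      ∀ l₁ ∈ Metric.closedBall l₀ r, ∀ l₂ ∈ Metric.closedBall l₀ r, ∀ t ∈ Icc (0:ℝ) T,
        ‖ζ l₁ t - ζ l₂ t‖ ≤ D * ‖l₁ - l₂‖ * t := by
  let G : E × P → E × P := fun x => (F x, 0)
  have hG : ContDiff ℝ 1 G := hF.prodMk contDiff_const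
  obtain ⟨ε, hε, a, r, L, K, hr, hpl⟩ :=
    IsPicardLindelof.of_contDiffAt_one (hG.contDiffAt (x := (z₀, l₀)))
  obtain ⟨α, hα, L', hL'⟩ :=
    (hpl 0).exists_forall_mem_closedBall_eq_hasDerivWithinAt_lipschitzOnWith
  simp only [zero_sub, zero_add] at hα hL'
  have hmem : ∀ l ∈ Metric.closedBall l₀ (r:ℝ), (z₀, l) ∈ Metric.closedBall (z₀, l₀) (r:ℝ) := by
    intro l hl
    simpa [Prod.dist_eq] using hl
  have hder : ∀ l ∈ Metric.closedBall l₀ (r:ℝ), ∀ t ∈ Icc (0:ℝ) (ε/2),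
      HasDerivAt (α (z₀, l)) (G (α (z₀, l) t)) t := by
    intro l hl t ht
    exact ((hα _ (hmem l hl)).2 t ⟨by linarith [ht.1], by linarith [ht.2]⟩).hasDerivAt
      (Icc_mem_nhds (by linarith [ht.1]) (by linarith [ht.2]))
  have hsnd : ∀ l ∈ Metric.closedBall l₀ (r:ℝ), ∀ t ∈ Icc (0:ℝ) (ε/2), (α (z₀, l) t).2 = l := by
    intro l hl t ht
    have h1 : ∀ t ∈ Icc (0:ℝ) (ε/2), HasDerivAt (fun t => (α (z₀, l) t).2) ((fun _ => (0:P)) t) t := by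
      intro t ht
      exact hasFDerivAt_snd.comp_hasDerivAt t (hder l hl t ht)
    have := aux_mv _ _ _ 0 h1 (by simp) t ht
    have h0 := (hα _ (hmem l hl)).1
    simp only [h0, zero_mul, norm_le_zero_iff, sub_eq_zero] at this
    exact this
  -- compact set containing everything
  have hcont : ContinuousOn (α (z₀, l₀)) (Icc (0:ℝ) (ε/2)) := fun t ht =>
    (hder l₀ (Metric.mem_closedBall_self r.2) t ht).continuousAt.continuousWithinAt
  obtain ⟨R₁, hR₁⟩ := (isCompact_Icc.image_of_continuousOn hcont).isBounded.subset_closedBall (z₀, l₀)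
  set R : ℝ := max 0 (R₁ + L' * r) with hR
  have hR0 : 0 ≤ R := le_max_left _ _
  have hlip : ∀ l₁ ∈ Metric.closedBall l₀ (r:ℝ), ∀ l₂ ∈ Metric.closedBall l₀ (r:ℝ),
      ∀ t ∈ Icc (0:ℝ) (ε/2), dist (α (z₀, l₁) t) (α (z₀, l₂) t) ≤ L' * ‖l₁ - l₂‖ := by
    intro l₁ h1 l₂ h2 t ht
    have := (hL' t ⟨by linarith [ht.1], by linarith [ht.2]⟩).dist_le_mul _ (hmem _ h1) _ (hmem _ h2)
    simpa [Prod.dist_eq, dist_eq_norm] using this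
  have hbd : ∀ l ∈ Metric.closedBall l₀ (r:ℝ), ∀ t ∈ Icc (0:ℝ) (ε/2),
      α (z₀, l) t ∈ Metric.closedBall (z₀, l₀) R := by
    intro l hl t ht
    have h1 := hlip l hl l₀ (Metric.mem_closedBall_self r.2) t ht
    have h2 : dist (α (z₀, l₀) t) (z₀, l₀) ≤ R₁ := hR₁ ⟨t, ht, rfl⟩
    have h3 := dist_triangle (α (z₀, l) t) (α (z₀, l₀) t) (z₀, l₀)
    have h4 : ‖l - l₀‖ ≤ r := by simpa [dist_eq_norm] using hl
    have h5 : (L':ℝ) * ‖l - l₀‖ ≤ L' * r := by gcongr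
    rw [Metric.mem_closedBall]
    exact le_trans (by linarith) (le_max_right _ _)
  obtain ⟨K', hK'⟩ := (hF.contDiffOn (s := Metric.closedBall (z₀, l₀) R)).exists_lipschitzOnWith
    one_ne_zero (convex_closedBall _ _) (isCompact_closedBall _ _)
  obtain ⟨B, hB⟩ := (isCompact_closedBall (z₀, l₀) R).exists_bound_of_continuousOn
    hF.continuous.continuousOn
  have hF1 : ∀ l ∈ Metric.closedBall l₀ (r:ℝ), ∀ t ∈ Icc (0:ℝ) (ε/2),
      HasDerivAt (fun t => (α (z₀, l) t).1) (F (α (z₀, l) t)) t := by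
    intro l hl t ht
    exact hasFDerivAt_fst.comp_hasDerivAt t (hder l hl t ht)
  set D : ℝ := max (max B 0) (K' * L') with hD
  refine ⟨r, hr, ε/2, by positivity, D, le_trans (le_max_right _ _) (le_max_left _ _), R, hR0,
    fun l t => (α (z₀, l) t).1, ?_, ?_⟩
  · intro l hl
    refine ⟨by show (α (z₀, l) 0).1 = z₀; rw [(hα _ (hmem l hl)).1], fun t ht => ⟨?_, ?_, ?_⟩⟩
    · have := hF1 l hl t ht
      convert this using 2
      exact Prod.ext rfl (hsnd l hl t ht).symm
    · have := aux_mv _ _ _ D (hF1 l hl)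
        (fun s hs => (hB _ (hbd l hl s hs)).trans (le_trans (le_max_left _ _) (le_max_left _ _))) t ht
      simpa [(hα _ (hmem l hl)).1] using this
    · have := hbd l hl t ht
      rw [Metric.mem_closedBall, Prod.dist_eq, max_le_iff, dist_eq_norm] at this
      exact this.1
  · intro l₁ h1 l₂ h2 t ht
    have := aux_mv (fun t => (α (z₀, l₁) t).1 - (α (z₀, l₂) t).1) _ _ (D * ‖l₁ - l₂‖)
      (fun s hs => (hF1 l₁ h1 s hs).sub (hF1 l₂ h2 s hs)) (fun s hs => ?_) t ht
    · simpa [(hα _ (hmem l₁ h1)).1, (hα _ (hmem l₂ h2)).1] using this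
    · have e1 := hK'.dist_le_mul _ (hbd l₁ h1 s hs) _ (hbd l₂ h2 s hs)
      have e2 := hlip l₁ h1 l₂ h2 s hs
      rw [dist_eq_norm] at e1
      calc _ ≤ _ := e1
        _ ≤ K' * (L' * ‖l₁ - l₂‖) := by gcongr
        _ = (K' * L') * ‖l₁ - l₂‖ := by ring
        _ ≤ D * ‖l₁ - l₂‖ := by gcongr; exact le_max_right _ _

theorem aux_twice {E : Type*} [NormedAddCommGroup E] [NormedSpace ℝ E]
    (x x' x'' : ℝ → E) (h C : ℝ) (hh : 0 < h) (hx : ∀ t ∈ Icc (0:ℝ) h, HasDerivAt x (x' t) t)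
    (hx' : ∀ t ∈ Icc (0:ℝ) h, HasDerivAt x' (x'' t) t)
    (hC : ∀ t ∈ Icc (0:ℝ) h, ‖x'' t‖ ≤ C) (h0 : x 0 = 0) (h0' : x' 0 = 0) :
    ‖x h‖ ≤ C * h ^ 2 := by
  have hC0 : 0 ≤ C := (norm_nonneg _).trans (hC 0 ⟨le_rfl, hh.le⟩)
  have h1 : ∀ t ∈ Icc (0:ℝ) h, ‖x' t‖ ≤ C * h := by
    intro t ht
    have := aux_mv x' x'' h C hx' hC t ht
    rw [h0', sub_zero] at this
    exact this.trans (mul_le_mul_of_nonneg_left ht.2 hC0)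
  have := aux_mv x x' h _ hx h1 h ⟨hh.le, le_rfl⟩
  rw [h0, sub_zero] at this
  linarith [this, sq h]

theorem aux_main {E P : Type*} [NormedAddCommGroup E] [NormedSpace ℝ E] [FiniteDimensional ℝ E]
    [NormedAddCommGroup P] [NormedSpace ℝ P] [FiniteDimensional ℝ P]
    (F : E × P → E) (hF : ContDiff ℝ 1 F) (γ κ a : E → P) (B : E → P →L[ℝ] P)
    (ha : ContDiff ℝ 1 a) (hB : ContDiff ℝ 1 B)
    (hγ : ∀ (z : ℝ → E) (l : P) (t : ℝ), HasDerivAt z (F (z t, l)) t →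
      HasDerivAt (fun s => γ (z s)) (κ (z t)) t)
    (hκ : ∀ (z : ℝ → E) (l : P) (t : ℝ), HasDerivAt z (F (z t, l)) t →
      HasDerivAt (fun s => κ (z s)) (a (z t) - B (z t) l) t)
    (z₀ : E) (l₀ : P) (hγ0 : γ z₀ = 0) (hκ0 : κ z₀ = 0) (A : P ≃L[ℝ] P)
    (hA : ∀ x, A x = B z₀ x) (hl₀ : a z₀ = B z₀ l₀) :
    ∃ h₀ > (0:ℝ), ∃ r > (0:ℝ), ∀ h ∈ Ioc (0:ℝ) h₀, ∃! l : P, ‖l - l₀‖ ≤ r ∧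
      ∃ z : ℝ → E, z 0 = z₀ ∧ (∀ t ∈ Icc (0:ℝ) h, HasDerivAt z (F (z t, l)) t) ∧ γ (z h) = 0 := by
  obtain ⟨r, hr, T, hT, D, hD, R, hR, ζ, hζ, hζ2⟩ := aux_flow F hF z₀ l₀
  obtain ⟨Ka, hKa⟩ := (ha.contDiffOn (s := Metric.closedBall z₀ R)).exists_lipschitzOnWith
    one_ne_zero (convex_closedBall _ _) (isCompact_closedBall _ _)
  obtain ⟨Kb, hKb⟩ := (hB.contDiffOn (s := Metric.closedBall z₀ R)).exists_lipschitzOnWith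
    one_ne_zero (convex_closedBall _ _) (isCompact_closedBall _ _)
  set Lm : ℝ := ‖l₀‖ + r with hLm
  set C : ℝ := D * (Ka + Kb * Lm + Kb) with hCdef
  have hC : 0 ≤ C := by positivity
  set N : ℝ := ‖(A.symm : P →L[ℝ] P)‖ with hN
  have hN0 : 0 ≤ N := norm_nonneg _
  have hmz : ∀ l ∈ Metric.closedBall l₀ r, ∀ t ∈ Icc (0:ℝ) T, ζ l t ∈ Metric.closedBall z₀ R := by
    intro l hl t ht
    rw [Metric.mem_closedBall, dist_eq_norm]
    exact ((hζ l hl).2 t ht).2.2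
  have hm0 : z₀ ∈ Metric.closedBall z₀ R := Metric.mem_closedBall_self hR
  have hl0 : l₀ ∈ Metric.closedBall l₀ r := Metric.mem_closedBall_self hr.le
  have hlm : ∀ l ∈ Metric.closedBall l₀ r, ‖l‖ ≤ Lm := by
    intro l hl
    have : ‖l - l₀‖ ≤ r := by simpa [dist_eq_norm] using hl
    have h2 : ‖l‖ ≤ ‖l₀‖ + ‖l - l₀‖ := norm_le_norm_add_norm_sub' l l₀
    linarith
  -- first key estimate
  have key1 : ∀ h ∈ Ioc (0:ℝ) T, ‖γ (ζ l₀ h)‖ ≤ (C * h) * h ^ 2 := by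
    intro h hh
    have hsub : ∀ t ∈ Icc (0:ℝ) h, t ∈ Icc (0:ℝ) T := fun t ht => ⟨ht.1, ht.2.trans hh.2⟩
    refine aux_twice (fun t => γ (ζ l₀ t)) (fun t => κ (ζ l₀ t))
      (fun t => a (ζ l₀ t) - B (ζ l₀ t) l₀) h _ hh.1
      (fun t ht => hγ _ l₀ t ((hζ l₀ hl0).2 t (hsub t ht)).1)
      (fun t ht => hκ _ l₀ t ((hζ l₀ hl0).2 t (hsub t ht)).1) ?_
      (by simp [(hζ l₀ hl0).1, hγ0]) (by simp [(hζ l₀ hl0).1, hκ0])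
    intro t ht
    have e1 : ‖a (ζ l₀ t) - a z₀‖ ≤ Ka * ‖ζ l₀ t - z₀‖ := by
      simpa [dist_eq_norm] using hKa.dist_le_mul _ (hmz l₀ hl0 t (hsub t ht)) _ hm0
    have e2 : ‖B (ζ l₀ t) - B z₀‖ ≤ Kb * ‖ζ l₀ t - z₀‖ := by
      simpa [dist_eq_norm] using hKb.dist_le_mul _ (hmz l₀ hl0 t (hsub t ht)) _ hm0
    have e3 : ‖ζ l₀ t - z₀‖ ≤ D * h :=
      ((hζ l₀ hl0).2 t (hsub t ht)).2.1.trans (mul_le_mul_of_nonneg_left ht.2 hD)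
    have e4 : a (ζ l₀ t) - B (ζ l₀ t) l₀ = (a (ζ l₀ t) - a z₀) - (B (ζ l₀ t) - B z₀) l₀ := by
      rw [hl₀, _root_.sub_apply]; abel
    have hh0 := hh.1.le
    calc ‖a (ζ l₀ t) - B (ζ l₀ t) l₀‖ ≤ ‖a (ζ l₀ t) - a z₀‖ + ‖(B (ζ l₀ t) - B z₀) l₀‖ := by
          rw [e4]; exact norm_sub_le _ _
      _ ≤ Ka * (D * h) + Kb * (D * h) * Lm := by
          gcongr
          · exact e1.trans (by gcongr)
          · refine (ContinuousLinearMap.le_opNorm _ _).trans ?_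
            have := e2.trans (mul_le_mul_of_nonneg_left e3 Kb.2)
            exact mul_le_mul this (hlm l₀ hl0) (norm_nonneg _) (by positivity)
      _ ≤ C * h := by
          have : 0 ≤ Kb * (D * h) := by positivity
          rw [hCdef]; nlinarith
  have key2 : ∀ h ∈ Ioc (0:ℝ) T, ∀ l₁ ∈ Metric.closedBall l₀ r, ∀ l₂ ∈ Metric.closedBall l₀ r,
      ‖γ (ζ l₁ h) - γ (ζ l₂ h) + (h ^ 2 / 2) • B z₀ (l₁ - l₂)‖ ≤ (C * h * ‖l₁ - l₂‖) * h ^ 2 := by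
    intro h hh l₁ h1 l₂ h2
    have hsub : ∀ t ∈ Icc (0:ℝ) h, t ∈ Icc (0:ℝ) T := fun t ht => ⟨ht.1, ht.2.trans hh.2⟩
    refine aux_twice (fun t => γ (ζ l₁ t) - γ (ζ l₂ t) + (t ^ 2 / 2) • B z₀ (l₁ - l₂))
      (fun t => κ (ζ l₁ t) - κ (ζ l₂ t) + t • B z₀ (l₁ - l₂))
      (fun t => (a (ζ l₁ t) - B (ζ l₁ t) l₁) - (a (ζ l₂ t) - B (ζ l₂ t) l₂) + B z₀ (l₁ - l₂))
      h _ hh.1 ?_ ?_ ?_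
      (by simp [(hζ l₁ h1).1, (hζ l₂ h2).1]) (by simp [(hζ l₁ h1).1, (hζ l₂ h2).1])
    · intro t ht
      refine ((hγ _ l₁ t ((hζ l₁ h1).2 t (hsub t ht)).1).sub
        (hγ _ l₂ t ((hζ l₂ h2).2 t (hsub t ht)).1)).add ?_
      have : HasDerivAt (fun t : ℝ => t ^ 2 / 2) t t := by
        simpa using (hasDerivAt_pow 2 t).div_const 2
      exact this.smul_const _
    · intro t ht
      refine ((hκ _ l₁ t ((hζ l₁ h1).2 t (hsub t ht)).1).sub
        (hκ _ l₂ t ((hζ l₂ h2).2 t (hsub t ht)).1)).add ?_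
      simpa using (hasDerivAt_id t).smul_const (B z₀ (l₁ - l₂))
    intro t ht
    have m1 := hmz l₁ h1 t (hsub t ht)
    have m2 := hmz l₂ h2 t (hsub t ht)
    set d := ‖l₁ - l₂‖ with hd
    have hd0 : 0 ≤ d := norm_nonneg _
    have e3 : ‖ζ l₁ t - ζ l₂ t‖ ≤ D * d * h :=
      (hζ2 l₁ h1 l₂ h2 t (hsub t ht)).trans (mul_le_mul_of_nonneg_left ht.2 (by positivity))
    have e3' : ‖ζ l₂ t - z₀‖ ≤ D * h :=
      ((hζ l₂ h2).2 t (hsub t ht)).2.1.trans (mul_le_mul_of_nonneg_left ht.2 hD)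
    have e1 : ‖a (ζ l₁ t) - a (ζ l₂ t)‖ ≤ Ka * (D * d * h) := by
      refine le_trans ?_ (mul_le_mul_of_nonneg_left e3 Ka.2)
      simpa [dist_eq_norm] using hKa.dist_le_mul _ m1 _ m2
    have e2 : ‖B (ζ l₁ t) - B (ζ l₂ t)‖ ≤ Kb * (D * d * h) := by
      refine le_trans ?_ (mul_le_mul_of_nonneg_left e3 Kb.2)
      simpa [dist_eq_norm] using hKb.dist_le_mul _ m1 _ m2
    have e2' : ‖B (ζ l₂ t) - B z₀‖ ≤ Kb * (D * h) := by
      refine le_trans ?_ (mul_le_mul_of_nonneg_left e3' Kb.2)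
      simpa [dist_eq_norm] using hKb.dist_le_mul _ m2 _ hm0
    have e4 : (a (ζ l₁ t) - B (ζ l₁ t) l₁) - (a (ζ l₂ t) - B (ζ l₂ t) l₂) + B z₀ (l₁ - l₂)
        = (a (ζ l₁ t) - a (ζ l₂ t)) - (B (ζ l₁ t) - B (ζ l₂ t)) l₁
          - (B (ζ l₂ t) - B z₀) (l₁ - l₂) := by
      simp only [_root_.sub_apply, map_sub]; abel
    have hh0 := hh.1.le
    have b1 : ‖(B (ζ l₁ t) - B (ζ l₂ t)) l₁‖ ≤ Kb * (D * d * h) * Lm :=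
      (ContinuousLinearMap.le_opNorm _ _).trans
        (mul_le_mul e2 (hlm l₁ h1) (norm_nonneg _) (by positivity))
    have b2 : ‖(B (ζ l₂ t) - B z₀) (l₁ - l₂)‖ ≤ Kb * (D * h) * d :=
      (ContinuousLinearMap.le_opNorm _ _).trans (mul_le_mul_of_nonneg_right e2' hd0)
    show ‖(a (ζ l₁ t) - B (ζ l₁ t) l₁) - (a (ζ l₂ t) - B (ζ l₂ t) l₂) + B z₀ (l₁ - l₂)‖ ≤ _
    rw [e4]
    refine (norm_sub_le _ _).trans ?_
    have := norm_sub_le (a (ζ l₁ t) - a (ζ l₂ t)) ((B (ζ l₁ t) - B (ζ l₂ t)) l₁)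
    have e5 : C * h * d = Ka * (D * d * h) + Kb * (D * d * h) * Lm + Kb * (D * h) * d := by
      rw [hCdef]; ring
    linarith
  have hNC : 0 < N * C + 1 := by positivity
  refine ⟨min T (min (1/4) (r/4) / (N * C + 1)), by positivity, r, hr, fun h hh => ?_⟩
  have hhT : h ∈ Ioc (0:ℝ) T := ⟨hh.1, hh.2.trans (min_le_left _ _)⟩
  have hh0 : 0 < h := hh.1
  have hsm : N * C * h ≤ min (1/4) (r/4) := by
    have h1 : h ≤ min (1/4) (r/4) / (N * C + 1) := hh.2.trans (min_le_right _ _)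
    rw [le_div_iff₀ hNC] at h1
    nlinarith
  have hs1 : 2 * (N * C * h) ≤ 1 / 2 := by linarith [min_le_left (1/4:ℝ) (r/4)]
  have hs2 : 2 * (N * C * h) ≤ r / 2 := by linarith [min_le_right (1/4:ℝ) (r/4)]
  let S : P → P := fun l => l + (2 / h ^ 2) • A.symm (γ (ζ l h))
  have hS : ∀ l₁ ∈ Metric.closedBall l₀ r, ∀ l₂ ∈ Metric.closedBall l₀ r,
      ‖S l₁ - S l₂‖ ≤ 1 / 2 * ‖l₁ - l₂‖ := by
    intro l₁ h1 l₂ h2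
    have e : S l₁ - S l₂ = (2 / h ^ 2) • (A.symm : P →L[ℝ] P)
        (γ (ζ l₁ h) - γ (ζ l₂ h) + (h ^ 2 / 2) • B z₀ (l₁ - l₂)) := by
      rw [← hA]
      have : (2 / h ^ 2) * (h ^ 2 / 2) = 1 := by field_simp
      simp only [S, ContinuousLinearEquiv.coe_coe, map_add, map_sub, map_smul,
        ContinuousLinearEquiv.symm_apply_apply, smul_add, smul_sub, smul_smul, this, one_smul]
      abel
    rw [e, norm_smul, Real.norm_of_nonneg (by positivity)]
    calc 2 / h ^ 2 * _ ≤ 2 / h ^ 2 * (N * ((C * h * ‖l₁ - l₂‖) * h ^ 2)) := by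
          gcongr
          exact (ContinuousLinearMap.le_opNorm _ _).trans
            (mul_le_mul_of_nonneg_left (key2 h hhT l₁ h1 l₂ h2) hN0)
      _ = 2 * (N * C * h) * ‖l₁ - l₂‖ := by field_simp
      _ ≤ _ := by gcongr
  have hS0 : ‖S l₀ - l₀‖ ≤ r / 2 := by
    have e : S l₀ - l₀ = (2 / h ^ 2) • (A.symm : P →L[ℝ] P) (γ (ζ l₀ h)) := by
      simp [S]
    rw [e, norm_smul, Real.norm_of_nonneg (by positivity)]
    calc 2 / h ^ 2 * _ ≤ 2 / h ^ 2 * (N * ((C * h) * h ^ 2)) := by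
          gcongr
          exact (ContinuousLinearMap.le_opNorm _ _).trans
            (mul_le_mul_of_nonneg_left (key1 h hhT) hN0)
      _ = 2 * (N * C * h) := by field_simp
      _ ≤ _ := hs2
  have hmaps : MapsTo S (Metric.closedBall l₀ r) (Metric.closedBall l₀ r) := by
    intro l hl
    have h1 := hS l hl l₀ hl0
    have h2 : ‖l - l₀‖ ≤ r := by simpa [dist_eq_norm] using hl
    rw [Metric.mem_closedBall, dist_eq_norm]
    have := norm_add_le (S l - S l₀) (S l₀ - l₀)
    rw [sub_add_sub_cancel] at this
    linarith
  have hcontr : ContractingWith (1/2) (hmaps.restrict S _ _) := by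
    refine ⟨by norm_num, LipschitzWith.of_dist_le_mul fun x y => ?_⟩
    have := hS x x.2 y y.2
    simpa [Subtype.dist_eq, dist_eq_norm] using this
  obtain ⟨l, hl, hfix, -⟩ := hcontr.exists_fixedPoint' Metric.isClosed_closedBall.isComplete hmaps
    hl0 (edist_ne_top _ _)
  have hfix_iff : ∀ l, S l = l ↔ γ (ζ l h) = 0 := by
    intro l
    have : (2 / h ^ 2) ≠ 0 := by positivity
    simp [S, hh0.ne']
  refine ⟨l, ⟨by simpa [dist_eq_norm] using hl, ζ l, (hζ l hl).1,
    fun t ht => ((hζ l hl).2 t ⟨ht.1, ht.2.trans hhT.2⟩).1, (hfix_iff l).1 hfix⟩, ?_⟩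
  rintro l' ⟨hl', z, hz0, hz, hzh⟩
  replace hl' : l' ∈ Metric.closedBall l₀ r := by simpa [dist_eq_norm] using hl'
  have heq : EqOn z (ζ l') (Icc 0 h) := by
    refine aux_unique (fun x => F (x, l')) (hF.comp (contDiff_id.prodMk contDiff_const)) h _ _ hz
      (fun t ht => ((hζ l' hl').2 t ⟨ht.1, ht.2.trans hhT.2⟩).1) ?_
    rw [hz0, (hζ l' hl').1]
  have hf' : S l' = l' := by
    rw [hfix_iff, ← heq ⟨hh0.le, le_rfl⟩, hzh]
  have h3 := hS l' hl' l hl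
  have hfix' : S l = l := hfix
  rw [hf', hfix'] at h3
  have : ‖l' - l‖ = 0 := le_antisymm (by linarith [norm_nonneg (l' - l)]) (norm_nonneg _)
  exact sub_eq_zero.1 (norm_eq_zero.1 this)

theorem aux_fst {E P : Type*} [NormedAddCommGroup E] [NormedSpace ℝ E]
    [NormedAddCommGroup P] [NormedSpace ℝ P] (z : ℝ → E × P) (z' : E × P) (t : ℝ)
    (hz : HasDerivAt z z' t) : HasDerivAt (fun s => (z s).1) z'.1 t :=
  HasFDerivAt.comp_hasDerivAt (l := Prod.fst) (l' := ContinuousLinearMap.fst ℝ E P) t hasFDerivAt_fst hz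

theorem aux_snd {E P : Type*} [NormedAddCommGroup E] [NormedSpace ℝ E]
    [NormedAddCommGroup P] [NormedSpace ℝ P] (z : ℝ → E × P) (z' : E × P) (t : ℝ)
    (hz : HasDerivAt z z' t) : HasDerivAt (fun s => (z s).2) z'.2 t :=
  HasFDerivAt.comp_hasDerivAt (l := Prod.snd) (l' := ContinuousLinearMap.snd ℝ E P) t hasFDerivAt_snd hz

theorem aux_comp_deriv {m ν : ℕ} (g : (Fin m → ℝ) → (Fin ν → ℝ)) (hg : Differentiable ℝ g)
    (q w : Fin m → ℝ) (b : Fin ν) : fderiv ℝ (fun x => g x b) q w = fderiv ℝ g q w b := by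
  rw [fderiv_apply (hg q) b]; rfl

theorem aux_sum_single {m : ℕ} (f : (Fin m → ℝ) →L[ℝ] ℝ) (w : Fin m → ℝ) :
    ∑ i, f (Pi.single i 1) * w i = f w := by
  conv_rhs => rw [pi_eq_sum_univ' w, map_sum]
  refine Finset.sum_congr rfl fun i _ => ?_
  rw [map_smul, smul_eq_mul, mul_comm]

theorem aux_grad_dot {m : ℕ} (U : (Fin m → ℝ) → ℝ) (q w : Fin m → ℝ) :
    grad U q ⬝ᵥ w = fderiv ℝ U q w := aux_sum_single _ _

theorem aux_gradMat {m ν : ℕ} (g : (Fin m → ℝ) → (Fin ν → ℝ)) (hg : Differentiable ℝ g)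
    (q w : Fin m → ℝ) : (gradMat g q)ᵀ *ᵥ w = fderiv ℝ g q w := by
  ext b
  rw [← aux_comp_deriv g hg]
  exact aux_sum_single _ _

theorem aux_hess {m ν : ℕ} (g : (Fin m → ℝ) → (Fin ν → ℝ)) (hg : ContDiff ℝ 2 g)
    (q w : Fin m → ℝ) : hessVec g q w w = fderiv ℝ (fderiv ℝ g) q w w := by
  have hd : Differentiable ℝ g := hg.differentiable (by norm_num)
  have hd2 : Differentiable ℝ (fderiv ℝ g) :=
    (hg.fderiv_right (m := 1) (by norm_num)).differentiable (by norm_num)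
  ext b
  unfold hessVec
  simp_rw [aux_comp_deriv g hd]
  have h1 : HasFDerivAt (fun x => fderiv ℝ g x w) ((fderiv ℝ (fderiv ℝ g) q).flip w) q := by
    simpa using (hd2 q).hasFDerivAt.clm_apply (hasFDerivAt_const w q)
  have h2 := hasFDerivAt_pi'.1 h1 b
  rw [h2.fderiv]; rfl

theorem aux_contDiff_grad {m : ℕ} (U : (Fin m → ℝ) → ℝ) (hU : ContDiff ℝ 2 U) :
    ContDiff ℝ 1 (grad U) := by
  rw [contDiff_pi]
  intro i
  exact (hU.fderiv_right (m := 1) (by norm_num)).clm_apply contDiff_const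

theorem aux_contDiff_gradMat {m ν : ℕ} (g : (Fin m → ℝ) → (Fin ν → ℝ)) (hg : ContDiff ℝ 2 g) :
    ContDiff ℝ 1 (fun x : (Fin m → ℝ) × (Fin ν → ℝ) => gradMat g x.1 *ᵥ x.2) := by
  rw [contDiff_pi]
  intro i
  show ContDiff ℝ 1 (fun x : (Fin m → ℝ) × (Fin ν → ℝ) =>
    ∑ b, fderiv ℝ (fun y => g y b) x.1 (Pi.single i 1) * x.2 b)
  refine ContDiff.sum fun b _ => ?_
  refine ContDiff.mul ?_ ?_
  · have h1 : ContDiff ℝ 2 (fun x => g x b) := contDiff_pi.1 hg b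
    exact ((h1.fderiv_right (m := 1) (by norm_num)).comp contDiff_fst).clm_apply contDiff_const
  · exact contDiff_pi.1 contDiff_snd b

theorem stmt7 {m ν : ℕ} (hmn : ν < m)
    (M : Matrix (Fin m) (Fin m) ℝ) (hM : M.PosDef)
    (U : (Fin m → ℝ) → ℝ) (hU : ∀ x, AnalyticAt ℝ U x)
    (g : (Fin m → ℝ) → (Fin ν → ℝ)) (hg : ∀ x, AnalyticAt ℝ g x)
    (q₀ p₀ : Fin m → ℝ)
    (hns : IsUnit ((gradMat g q₀)ᵀ * M⁻¹ * gradMat g q₀))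
    (hg0 : g q₀ = 0)
    (hh0 : (gradMat g q₀)ᵀ *ᵥ (M⁻¹ *ᵥ p₀) = 0) :
    ∃ h₀ > 0, ∃ r > 0, ∀ h ∈ Set.Ioc (0:ℝ) h₀,
      (∃! lam : Fin ν → ℝ, ‖lam - lagMult M U g q₀ p₀‖ ≤ r ∧
        ∃ u v : ℝ → Fin m → ℝ, u 0 = q₀ ∧ v 0 = p₀ ∧
          (∀ t ∈ Set.Icc (0:ℝ) h, HasDerivAt u (M⁻¹ *ᵥ v t) t ∧
            HasDerivAt v (-(grad U (u t) + gradMat g (u t) *ᵥ lam)) t) ∧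
          g (u h) = 0) ∧
      ∀ lam : Fin ν → ℝ, ‖lam - lagMult M U g q₀ p₀‖ ≤ r →
        ∀ u v : ℝ → Fin m → ℝ, u 0 = q₀ → v 0 = p₀ →
          (∀ t ∈ Set.Icc (0:ℝ) h, HasDerivAt u (M⁻¹ *ᵥ v t) t ∧
            HasDerivAt v (-(grad U (u t) + gradMat g (u t) *ᵥ lam)) t) →
          g (u h) = 0 →
          Ham M U (u h) (v h) = Ham M U q₀ p₀ := by
  have hU2 : ContDiff ℝ 2 U := contDiff_iff_contDiffAt.2 fun x => (hU x).contDiffAt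
  have hg2 : ContDiff ℝ 2 g := contDiff_iff_contDiffAt.2 fun x => (hg x).contDiffAt
  have hgd : Differentiable ℝ g := hg2.differentiable (by norm_num)
  have hUd : Differentiable ℝ U := hU2.differentiable (by norm_num)
  have hg1 : ContDiff ℝ 1 (fderiv ℝ g) := hg2.fderiv_right (by norm_num)
  have hgω : ContDiff ℝ 3 g := contDiff_iff_contDiffAt.2 fun x => (hg x).contDiffAt
  have hgg : ContDiff ℝ 1 (fderiv ℝ (fderiv ℝ g)) :=
    (hgω.fderiv_right (m := 2) (by norm_num)).fderiv_right (m := 1) (by norm_num)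
  have hgd2 : Differentiable ℝ (fderiv ℝ g) := hg1.differentiable (by norm_num)
  let W : (Fin m → ℝ) →L[ℝ] (Fin m → ℝ) := LinearMap.toContinuousLinearMap (Matrix.mulVecLin M⁻¹)
  have hW : ∀ x, W x = M⁻¹ *ᵥ x := fun x => rfl
  let F : ((Fin m → ℝ) × (Fin m → ℝ)) × (Fin ν → ℝ) → (Fin m → ℝ) × (Fin m → ℝ) :=
    fun x => (W x.1.2, -(grad U x.1.1 + gradMat g x.1.1 *ᵥ x.2))
  have hF : ContDiff ℝ 1 F := by
    refine (W.contDiff.comp (contDiff_snd.comp contDiff_fst)).prodMk (ContDiff.neg ?_)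
    refine ((aux_contDiff_grad U hU2).comp (contDiff_fst.comp contDiff_fst)).add ?_
    exact (aux_contDiff_gradMat g hg2).comp ((contDiff_fst.comp contDiff_fst).prodMk contDiff_snd)
  let γ : (Fin m → ℝ) × (Fin m → ℝ) → (Fin ν → ℝ) := fun z => g z.1
  let κ : (Fin m → ℝ) × (Fin m → ℝ) → (Fin ν → ℝ) := fun z => fderiv ℝ g z.1 (W z.2)
  let a : (Fin m → ℝ) × (Fin m → ℝ) → (Fin ν → ℝ) := fun z =>
    fderiv ℝ (fderiv ℝ g) z.1 (W z.2) (W z.2) - fderiv ℝ g z.1 (W (grad U z.1))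
  let B : (Fin m → ℝ) × (Fin m → ℝ) → (Fin ν → ℝ) →L[ℝ] (Fin ν → ℝ) := fun z =>
    (fderiv ℝ g z.1).comp (W.comp (LinearMap.toContinuousLinearMap (Matrix.mulVecLin (gradMat g z.1))))
  have hBap : ∀ z l, B z l = fderiv ℝ g z.1 (W (gradMat g z.1 *ᵥ l)) := fun z l => rfl
  have ha : ContDiff ℝ 1 a := by
    refine ContDiff.sub ?_ ?_
    · exact ((hgg.comp contDiff_fst).clm_apply (W.contDiff.comp contDiff_snd)).clm_apply
        (W.contDiff.comp contDiff_snd)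
    · exact (hg1.comp contDiff_fst).clm_apply
        (W.contDiff.comp ((aux_contDiff_grad U hU2).comp contDiff_fst))
  have hB : ContDiff ℝ 1 B := by
    rw [contDiff_clm_apply_iff]
    intro l
    simp only [hBap]
    exact (hg1.comp contDiff_fst).clm_apply (W.contDiff.comp
      ((aux_contDiff_gradMat g hg2).comp (contDiff_fst.prodMk contDiff_const)))
  have hγ : ∀ (z : ℝ → (Fin m → ℝ) × (Fin m → ℝ)) (l : Fin ν → ℝ) (t : ℝ),
      HasDerivAt z (F (z t, l)) t → HasDerivAt (fun s => γ (z s)) (κ (z t)) t := by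
    intro z l t hz
    have h1 : HasDerivAt (fun s => (z s).1) (W (z t).2) t :=
      aux_fst z _ t hz
    exact (hgd (z t).1).hasFDerivAt.comp_hasDerivAt t h1
  have hκ : ∀ (z : ℝ → (Fin m → ℝ) × (Fin m → ℝ)) (l : Fin ν → ℝ) (t : ℝ),
      HasDerivAt z (F (z t, l)) t →
      HasDerivAt (fun s => κ (z s)) (a (z t) - B (z t) l) t := by
    intro z l t hz
    have h1 : HasDerivAt (fun s => (z s).1) (W (z t).2) t :=
      aux_fst z _ t hz
    have h2 : HasDerivAt (fun s => (z s).2) (-(grad U (z t).1 + gradMat g (z t).1 *ᵥ l)) t :=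
      aux_snd z _ t hz
    have h3 : HasDerivAt (fun s => fderiv ℝ g (z s).1) (fderiv ℝ (fderiv ℝ g) (z t).1 (W (z t).2)) t :=
      (hgd2 (z t).1).hasFDerivAt.comp_hasDerivAt t h1
    have h4 : HasDerivAt (fun s => W (z s).2) (W (-(grad U (z t).1 + gradMat g (z t).1 *ᵥ l))) t :=
      W.hasFDerivAt.comp_hasDerivAt t h2
    refine (h3.clm_apply h4).congr_deriv ?_
    show _ = fderiv ℝ (fderiv ℝ g) (z t).1 (W (z t).2) (W (z t).2)
      - fderiv ℝ g (z t).1 (W (grad U (z t).1)) - fderiv ℝ g (z t).1 (W (gradMat g (z t).1 *ᵥ l))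
    simp only [map_neg, map_add]
    abel
  set S := (gradMat g q₀)ᵀ * M⁻¹ * gradMat g q₀ with hS
  have hdet : IsUnit S.det := (Matrix.isUnit_iff_isUnit_det S).1 hns
  have hSB : ∀ x, S *ᵥ x = B (q₀, p₀) x := by
    intro x
    rw [hBap, ← aux_gradMat g hgd, hW, hS, Matrix.mulVec_mulVec, Matrix.mulVec_mulVec,
      Matrix.mul_assoc]
  let A : (Fin ν → ℝ) ≃L[ℝ] (Fin ν → ℝ) := ContinuousLinearEquiv.equivOfInverse
    (LinearMap.toContinuousLinearMap (Matrix.mulVecLin S))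
    (LinearMap.toContinuousLinearMap (Matrix.mulVecLin S⁻¹))
    (fun x => by simp [Matrix.mulVec_mulVec, Matrix.nonsing_inv_mul S hdet])
    (fun x => by simp [Matrix.mulVec_mulVec, Matrix.mul_nonsing_inv S hdet])
  have hA : ∀ x, A x = B (q₀, p₀) x := fun x => hSB x
  have hl₀ : a (q₀, p₀) = B (q₀, p₀) (lagMult M U g q₀ p₀) := by
    rw [← hSB]
    unfold lagMult
    rw [← hS, Matrix.mulVec_mulVec, Matrix.mul_nonsing_inv S hdet, Matrix.one_mulVec,
      aux_hess g hg2, aux_gradMat g hgd]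
    rfl
  obtain ⟨h₀, hh₀, r, hr, H⟩ := aux_main F hF γ κ a B ha hB hγ hκ (q₀, p₀) (lagMult M U g q₀ p₀)
    hg0 (by rw [← hh0, aux_gradMat g hgd]; rfl) A hA hl₀
  refine ⟨h₀, hh₀, r, hr, fun h hh => ⟨?_, ?_⟩⟩
  · obtain ⟨l, ⟨hl, z, hz0, hz, hzh⟩, huniq⟩ := H h hh
    refine ⟨l, ⟨hl, fun t => (z t).1, fun t => (z t).2, by simp [hz0], by simp [hz0],
      fun t ht => ⟨?_, ?_⟩, hzh⟩, ?_⟩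
    · exact aux_fst z _ t (hz t ht)
    · exact aux_snd z _ t (hz t ht)
    · rintro l' ⟨hl', u, v, hu0, hv0, huv, huh⟩
      exact huniq l' ⟨hl', fun t => (u t, v t), by simp [hu0, hv0],
        fun t ht => (huv t ht).1.prodMk (huv t ht).2, huh⟩
  · intro l _ u v hu0 hv0 huv huh
    have hsymm : (M⁻¹)ᵀ = M⁻¹ := by
      have := hM.isHermitian.inv
      simpa [Matrix.IsHermitian, Matrix.conjTranspose_eq_transpose_of_trivial] using this
    have hsw : ∀ x y : Fin m → ℝ, x ⬝ᵥ (M⁻¹ *ᵥ y) = y ⬝ᵥ (M⁻¹ *ᵥ x) := by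
      intro x y
      rw [Matrix.dotProduct_mulVec, ← Matrix.mulVec_transpose, hsymm, dotProduct_comm]
    have hdot : ∀ {k : ℕ} (x y x' y' : ℝ → Fin k → ℝ) (t : ℝ), HasDerivAt x (x' t) t →
        HasDerivAt y (y' t) t →
        HasDerivAt (fun s => x s ⬝ᵥ y s) (x' t ⬝ᵥ y t + x t ⬝ᵥ y' t) t := by
      intro k x y x' y' t hx hy
      simp only [dotProduct, ← Finset.sum_add_distrib]
      exact HasDerivAt.fun_sum fun i _ => (hasDerivAt_pi.1 hx i).mul (hasDerivAt_pi.1 hy i)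
    have hder : ∀ t ∈ Icc (0:ℝ) h,
        HasDerivAt (fun s => Ham M U (u s) (v s) + l ⬝ᵥ g (u s)) ((fun _ => (0:ℝ)) t) t := by
      intro t ht
      obtain ⟨h1, h2⟩ := huv t ht
      have h3 : HasDerivAt (fun s => M⁻¹ *ᵥ v s)
          (M⁻¹ *ᵥ (-(grad U (u t) + gradMat g (u t) *ᵥ l))) t :=
        W.hasFDerivAt.comp_hasDerivAt t h2
      have h4 := hdot v (fun s => M⁻¹ *ᵥ v s) (fun t => -(grad U (u t) + gradMat g (u t) *ᵥ l))
        (fun t => M⁻¹ *ᵥ (-(grad U (u t) + gradMat g (u t) *ᵥ l))) t h2 h3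
      have h5 : HasDerivAt (fun s => U (u s)) (fderiv ℝ U (u t) (M⁻¹ *ᵥ v t)) t :=
        (hUd (u t)).hasFDerivAt.comp_hasDerivAt t h1
      have h6 : HasDerivAt (fun s => g (u s)) (fderiv ℝ g (u t) (M⁻¹ *ᵥ v t)) t :=
        (hgd (u t)).hasFDerivAt.comp_hasDerivAt t h1
      have h7 := hdot (fun _ => l) (fun s => g (u s)) (fun _ => 0)
        (fun t => fderiv ℝ g (u t) (M⁻¹ *ᵥ v t)) t (hasDerivAt_const t l) h6
      have h8 := ((h4.const_mul (1/2)).add h5).add h7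
      refine h8.congr_deriv ?_
      have e1 := aux_grad_dot U (u t) (M⁻¹ *ᵥ v t)
      have e2 : (gradMat g (u t) *ᵥ l) ⬝ᵥ (M⁻¹ *ᵥ v t) = l ⬝ᵥ fderiv ℝ g (u t) (M⁻¹ *ᵥ v t) := by
        rw [← aux_gradMat g hgd, Matrix.dotProduct_mulVec l, Matrix.vecMul_transpose]
      rw [hsw (v t)]
      simp only [neg_dotProduct, add_dotProduct, zero_dotProduct, e1, e2]
      ring
    have hfin := aux_mv _ _ h 0 hder (by simp) h ⟨hh.1.le, le_rfl⟩
    simp only [hu0, hv0, huh, hg0, dotProduct_zero, add_zero, zero_mul, norm_le_zero_iff,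
      sub_eq_zero] at hfin
    exact hfin
end

section
/- Assume U and g are real-analytic, let (q₀, p₀) satisfy ∇g(q₀)ᵀM⁻¹∇g(q₀) nonsingular, g(q₀) = 0 and ∇g(q₀)ᵀM⁻¹p₀ = 0, and let (q, p) : [0,T] → ℝ^m × ℝ^m be differentiable with q(0) = q₀, p(0) = p₀, q̇ = M⁻¹p, ṗ = −∇U(q) − ∇g(q)·λ(q,p) and g(q(t)) = 0 on [0,T]. Then there exist C > 0, r > 0 and h₀ > 0 such that for every h ∈ (0, h₀], every λ₀ ∈ ℝ^ν with ‖λ₀ − λ(q₀,p₀)‖ ≤ r, and every C¹ pair (u, v) on [0,h] solving u̇ = M⁻¹v, v̇ = −∇U(u) − ∇g(u)λ₀, u(0) = q₀, v(0) = p₀ with g(u(h)) = 0, one has: ‖λ₀ − λ(q₀,p₀)‖ ≤ C·h, ‖u(h) − q(h)‖ ≤ C·h², ‖v(h) − p(h)‖ ≤ C·h², and ‖∇g(u(h))ᵀM⁻¹v(h)‖ ≤ C·h². -/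
open MeasureTheory Matrix Set

theorem aux_base {X Y : Type*} [NormedAddCommGroup X] [NormedSpace ℝ X] [NormedAddCommGroup Y]
    [NormedSpace ℝ Y] {f : X → Y} {x₀ : X} (hf : DifferentiableAt ℝ f x₀) :
    ∃ K ≥ (0:ℝ), ∃ ρ > (0:ℝ), ∀ x, ‖x - x₀‖ ≤ ρ → ‖f x - f x₀‖ ≤ K * ‖x - x₀‖ := by
  obtain ⟨c, hc, h⟩ := hf.isBigO_sub.exists_nonneg
  rw [Asymptotics.isBigOWith_iff] at h
  obtain ⟨ε, hε, h⟩ := Metric.eventually_nhds_iff.1 h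
  refine ⟨c, hc, ε / 2, by positivity, fun x hx => h ?_⟩
  rw [dist_eq_norm]; linarith

theorem aux_lip {X Y : Type*} [NormedAddCommGroup X] [NormedSpace ℝ X] [NormedAddCommGroup Y]
    [NormedSpace ℝ Y] {f : X → Y} {x₀ : X} (hf : ContDiffAt ℝ 1 f x₀) :
    ∃ K ≥ (0:ℝ), ∃ ρ > (0:ℝ), ∀ x y, ‖x - x₀‖ ≤ ρ → ‖y - x₀‖ ≤ ρ →
      ‖f x - f y‖ ≤ K * ‖x - y‖ := by
  obtain ⟨K, t, ht, h⟩ := hf.exists_lipschitzOnWith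
  obtain ⟨ε, hε, hb⟩ := Metric.mem_nhds_iff.1 ht
  refine ⟨K, K.2, ε / 2, by positivity, fun x y hx hy => ?_⟩
  have := h.dist_le_mul x (hb ?_) y (hb ?_)
  · simpa only [dist_eq_norm] using this
  · rw [Metric.mem_ball, dist_eq_norm]; linarith
  · rw [Metric.mem_ball, dist_eq_norm]; linarith

theorem aux_conf {X : Type*} [NormedAddCommGroup X] [NormedSpace ℝ X] {z z' : ℝ → X} {h B ρ : ℝ}
    (hz : ∀ t ∈ Set.Icc (0:ℝ) h, HasDerivAt z (z' t) t)
    (hb : ∀ t ∈ Set.Icc (0:ℝ) h, ‖z t - z 0‖ ≤ ρ → ‖z' t‖ ≤ B) (hB : 0 ≤ B)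
    (hh : (B + 1) * h ≤ ρ) : ∀ t ∈ Set.Icc (0:ℝ) h, ‖z t - z 0‖ ≤ (B + 1) * t := by
  intro t ht
  have key := image_norm_le_of_norm_deriv_right_lt_deriv_boundary (f := fun t => z t - z 0)
    (f' := z') (a := 0) (b := h) (B := fun t => (B + 1) * t) (B' := fun _ => B + 1)
    (fun t ht => ((hz t ht).continuousAt.sub continuousAt_const).continuousWithinAt)
    (fun t ht => ((hz t (Set.Ico_subset_Icc_self ht)).sub_const _).hasDerivWithinAt)
    (by simp) (fun t => by simpa using (hasDerivAt_id t).const_mul (B + 1))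
    (fun t ht he => ?_) ht
  · exact key
  · have := hb t (Set.Ico_subset_Icc_self ht) (he.le.trans (le_trans ?_ hh))
    · linarith
    · have := ht.2
      show (B + 1) * t ≤ (B + 1) * h
      gcongr

theorem aux_mv_s8 {X : Type*} [NormedAddCommGroup X] [NormedSpace ℝ X] {z z' : ℝ → X} {h B : ℝ}
    (hz : ∀ t ∈ Set.Icc (0:ℝ) h, HasDerivAt z (z' t) t)
    (hb : ∀ t ∈ Set.Icc (0:ℝ) h, ‖z' t‖ ≤ B) (h0 : z 0 = 0) :
    ∀ t ∈ Set.Icc (0:ℝ) h, ‖z t‖ ≤ B * t := by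
  intro t ht
  have := norm_image_sub_le_of_norm_deriv_le_segment' (fun t ht => (hz t ht).hasDerivWithinAt)
    (fun t ht => hb t (Set.Ico_subset_Icc_self ht)) t ht
  simpa [h0] using this

set_option maxHeartbeats 4000000 in
theorem core {E F : Type*} [NormedAddCommGroup E] [NormedSpace ℝ E] [NormedAddCommGroup F]
    [NormedSpace ℝ F] (N : E →L[ℝ] E) (f : E × F → E) (g : E → F) (Λ : E × E → F) (q₀ p₀ : E)
    (hg : ContDiff ℝ 3 g) (hf : ContDiff ℝ 1 f) (hΛ : DifferentiableAt ℝ Λ (q₀, p₀))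
    (Ai : F →L[ℝ] F) (hg0 : g q₀ = 0) (hh0 : fderiv ℝ g q₀ (N p₀) = 0)
    (hA : ∀ l, Ai (fderiv ℝ (fderiv ℝ g) q₀ (N p₀) (N p₀) + fderiv ℝ g q₀ (N (f (q₀, l))))
      = Λ (q₀, p₀) - l)
    (T : ℝ) (hT : 0 < T)
    (q p : ℝ → E) (hq0 : q 0 = q₀) (hp0 : p 0 = p₀)
    (hq : ∀ t ∈ Set.Icc (0:ℝ) T, HasDerivAt q (N (p t)) t)
    (hp : ∀ t ∈ Set.Icc (0:ℝ) T, HasDerivAt p (f (q t, Λ (q t, p t))) t) :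
    ∃ C > 0, ∃ r > 0, ∃ h₀ > 0, h₀ ≤ T ∧
      ∀ h ∈ Set.Ioc (0:ℝ) h₀,
        ∀ lam : F, ‖lam - Λ (q₀, p₀)‖ ≤ r →
          ∀ u v : ℝ → E, u 0 = q₀ → v 0 = p₀ →
            (∀ t ∈ Set.Icc (0:ℝ) h, HasDerivAt u (N (v t)) t ∧
              HasDerivAt v (f (u t, lam)) t) →
            g (u h) = 0 →
            ‖lam - Λ (q₀, p₀)‖ ≤ C * h ∧
            ‖u h - q h‖ ≤ C * h ^ 2 ∧
            ‖v h - p h‖ ≤ C * h ^ 2 ∧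
            ‖fderiv ℝ g (u h) (N (v h))‖ ≤ C * h ^ 2 := by
  set ls := Λ (q₀, p₀) with hls
  set Φ : (E × E) × F → F := fun z => fderiv ℝ (fderiv ℝ g) z.1.1 (N z.1.2) (N z.1.2)
    + fderiv ℝ g z.1.1 (N (f (z.1.1, z.2))) with hΦ
  have hg1 : ContDiff ℝ 2 (fderiv ℝ g) := hg.fderiv_right (by norm_num)
  have hg2 : ContDiff ℝ 1 (fderiv ℝ (fderiv ℝ g)) := hg1.fderiv_right (by norm_num)
  have hg1' : ContDiff ℝ 1 (fderiv ℝ g) := hg1.of_le (by norm_num)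
  have hΦc : ContDiff ℝ 1 Φ := by
    rw [hΦ]; fun_prop
  obtain ⟨L, hL, ρ₁, hρ₁, HL⟩ := aux_lip (x₀ := ((q₀, p₀), ls)) hΦc.contDiffAt
  obtain ⟨Kf, hKf, ρ₂, hρ₂, Hf⟩ := aux_base (x₀ := (q₀, ls)) (hf.differentiable (by norm_num)).differentiableAt
  obtain ⟨KΛ, hKΛ, ρ₃, hρ₃, HΛ⟩ := aux_base hΛ
  set ρ := min (min ρ₁ ρ₂) (min ρ₃ 1) with hρ
  have hρ0 : 0 < ρ := by positivity
  have hr1 : ρ ≤ ρ₁ := by simp [hρ]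
  have hr2 : ρ ≤ ρ₂ := by simp [hρ]
  have hr3 : ρ ≤ ρ₃ := by simp [hρ]
  have hr4 : ρ ≤ 1 := by simp [hρ]
  set ρ' := ρ / (KΛ + 1) with hρ'
  have hρ'0 : 0 < ρ' := by positivity
  have hρ'1 : ρ' ≤ ρ := by
    rw [hρ']; exact div_le_self hρ0.le (by linarith)
  have hρ'2 : KΛ * ρ' ≤ ρ := by
    have : (KΛ + 1) * ρ' = ρ := by rw [hρ']; field_simp
    nlinarith
  set B := ‖N‖ * (‖p₀‖ + 1) + ‖f (q₀, ls)‖ + Kf with hB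
  have hB0 : 0 ≤ B := by positivity
  set D := B + 1 with hD
  have hD0 : 0 < D := by positivity
  -- bound for the vector field
  have fbd : ∀ x l, ∀ a, ‖x - q₀‖ ≤ a → ‖l - ls‖ ≤ a → a ≤ ρ →
      ‖f (x, l) - f (q₀, ls)‖ ≤ Kf * a := by
    intro x l a h1 h2 h3
    have h4 : ‖(x, l) - (q₀, ls)‖ ≤ a := by
      rw [Prod.mk_sub_mk, Prod.norm_mk]; exact max_le h1 h2
    exact (Hf _ (by linarith)).trans (by gcongr)
  have vbd : ∀ x y l, ‖(x, y) - (q₀, p₀)‖ ≤ ρ → ‖l - ls‖ ≤ ρ → ‖(N y, f (x, l))‖ ≤ B := by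
    intro x y l h1 h2
    rw [Prod.mk_sub_mk, Prod.norm_mk, max_le_iff] at h1
    have h3 : ‖y‖ ≤ ‖p₀‖ + 1 := by
      have := norm_le_norm_add_norm_sub p₀ y
      rw [norm_sub_rev] at this
      linarith [h1.2]
    have h4 : ‖N y‖ ≤ ‖N‖ * (‖p₀‖ + 1) := (N.le_opNorm y).trans (by gcongr)
    have h5 := fbd x l ρ h1.1 h2 le_rfl
    have h6 := norm_le_norm_add_norm_sub (f (q₀, ls)) (f (x, l))
    rw [norm_sub_rev] at h6
    have h7 : Kf * ρ ≤ Kf := by nlinarith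
    have h8 : 0 ≤ ‖N‖ * (‖p₀‖ + 1) := by positivity
    have h9 := norm_nonneg (f (q₀, ls))
    rw [Prod.norm_mk]
    exact max_le (by linarith) (by linarith)
  set C1 := ‖Ai‖ * (2 * (L * D)) with hC1
  set C2 := Kf * (D + C1) + Kf * (D + KΛ * D) with hC2
  set C3 := ‖N‖ * (2 * D) with hC3
  have hC10 : 0 ≤ C1 := by positivity
  have hC20 : 0 ≤ C2 := by positivity
  have hC30 : 0 ≤ C3 := by positivity
  have hLD : 0 ≤ L * D := by positivity
  set h₀ := min T (min (ρ' / D) (min (ρ / (D + C1)) (ρ / (D + KΛ * D)))) with hh₀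
  refine ⟨C1 + C2 + C3 + 3 * (L * D) + 1, by positivity, ρ, hρ0, h₀, by positivity,
    min_le_left _ _, ?_⟩
  rintro h ⟨h0, hh⟩ lam hlam u v hu0 hv0 huv hgu
  have hhT : h ≤ T := hh.trans (min_le_left _ _)
  have hh1 : D * h ≤ ρ' := by
    have : h ≤ ρ' / D := hh.trans (by simp [hh₀])
    rwa [le_div_iff₀ hD0, mul_comm] at this
  have hh2 : (D + C1) * h ≤ ρ := by
    have : h ≤ ρ / (D + C1) := hh.trans (by simp [hh₀])
    rwa [le_div_iff₀ (by positivity), mul_comm] at this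
  have hh3 : (D + KΛ * D) * h ≤ ρ := by
    have : h ≤ ρ / (D + KΛ * D) := hh.trans (by simp [hh₀])
    rwa [le_div_iff₀ (by positivity), mul_comm] at this
  have hsub : ∀ t ∈ Set.Icc (0:ℝ) h, t ∈ Set.Icc (0:ℝ) T := fun t ht => ⟨ht.1, ht.2.trans hhT⟩
  have cu : ∀ t ∈ Set.Icc (0:ℝ) h, ‖(u t, v t) - (q₀, p₀)‖ ≤ D * t := by
    have := aux_conf (z := fun t => (u t, v t)) (h := h) (B := B) (ρ := ρ')
      (fun t ht => (huv t ht).1.prodMk (huv t ht).2)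
      (fun t ht hb => vbd _ _ _ (by simpa only [hu0, hv0] using hb.trans hρ'1) hlam) hB0 hh1
    simpa only [hu0, hv0] using this
  have cq : ∀ t ∈ Set.Icc (0:ℝ) h, ‖(q t, p t) - (q₀, p₀)‖ ≤ D * t := by
    have := aux_conf (z := fun t => (q t, p t)) (h := h) (B := B) (ρ := ρ')
      (fun t ht => (hq t (hsub t ht)).prodMk (hp t (hsub t ht)))
      (fun t ht hb => by
        simp only [hq0, hp0] at hb
        refine vbd _ _ _ (hb.trans hρ'1) ((HΛ _ (by linarith)).trans (le_trans ?_ hρ'2))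
        gcongr) hB0 hh1
    simpa only [hq0, hp0] using this
  have hDt : ∀ t ∈ Set.Icc (0:ℝ) h, D * t ≤ D * h := fun t ht => by
    have := ht.2
    gcongr
  have hh' : h ∈ Set.Icc (0:ℝ) h := ⟨h0.le, le_rfl⟩
  -- derivatives of the constraint
  set c := Φ ((q₀, p₀), lam) with hc
  have d1 : ∀ t ∈ Set.Icc (0:ℝ) h, HasDerivAt (fun t => g (u t)) (fderiv ℝ g (u t) (N (v t))) t :=
    fun t ht => ((hg.differentiable (by norm_num)) (u t)).hasFDerivAt.comp_hasDerivAt t (huv t ht).1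
  have d2 : ∀ t ∈ Set.Icc (0:ℝ) h, HasDerivAt (fun t => fderiv ℝ g (u t) (N (v t)))
      (Φ ((u t, v t), lam)) t := by
    intro t ht
    have e1 : HasDerivAt (fun t => fderiv ℝ g (u t)) (fderiv ℝ (fderiv ℝ g) (u t) (N (v t))) t :=
      ((hg1.differentiable (by norm_num)) (u t)).hasFDerivAt.comp_hasDerivAt t (huv t ht).1
    have e2 : HasDerivAt (fun t => N (v t)) (N (f (u t, lam))) t :=
      N.hasFDerivAt.comp_hasDerivAt t (huv t ht).2
    exact e1.clm_apply e2
  have Φb : ∀ t ∈ Set.Icc (0:ℝ) h, ‖Φ ((u t, v t), lam) - c‖ ≤ L * D * h := by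
    intro t ht
    have h1 := (cu t ht).trans (hDt t ht)
    have := HL ((u t, v t), lam) ((q₀, p₀), lam) ?_ ?_
    · refine this.trans ?_
      rw [Prod.mk_sub_mk _ _ lam lam, Prod.norm_mk, sub_self, norm_zero, max_eq_left (norm_nonneg _), mul_assoc]
      gcongr
    · rw [Prod.mk_sub_mk _ _ lam ls, Prod.norm_mk]
      exact max_le (by linarith) (by linarith)
    · rw [Prod.mk_sub_mk _ _ lam ls, Prod.norm_mk, sub_self, norm_zero]
      exact max_le (by linarith) (by linarith)
  have s1 : ∀ t ∈ Set.Icc (0:ℝ) h, ‖fderiv ℝ g (u t) (N (v t)) - t • c‖ ≤ L * D * h * t := by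
    refine aux_mv_s8 (z' := fun t => Φ ((u t, v t), lam) - c) (fun t ht => ?_) Φb ?_
    · have e := (hasDerivAt_id t).smul_const c
      rw [one_smul] at e
      exact (d2 t ht).sub e
    · simp [hu0, hv0, hh0]
  have s2 : ‖g (u h) - (h ^ 2 / 2) • c‖ ≤ L * D * h * h * h := by
    refine aux_mv_s8 (z := fun t => g (u t) - (t ^ 2 / 2) • c)
      (z' := fun t => fderiv ℝ g (u t) (N (v t)) - t • c) (fun t ht => ?_)
      (fun t ht => (s1 t ht).trans ?_) ?_ h hh'
    · have e : HasDerivAt (fun t : ℝ => t ^ 2 / 2) t t := by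
        simpa using ((hasDerivAt_id t).pow 2).div_const 2
      exact (d1 t ht).sub (e.smul_const c)
    · have := ht.2
      gcongr
    · simp [hu0, hg0]
  have s3 : ‖c‖ ≤ 2 * (L * D) * h := by
    rw [hgu, zero_sub, norm_neg, norm_smul, Real.norm_of_nonneg (by positivity)] at s2
    have : h ^ 2 / 2 * ‖c‖ ≤ h ^ 2 / 2 * (2 * (L * D) * h) := by linarith
    exact le_of_mul_le_mul_left this (by positivity)
  have r1 : ‖lam - ls‖ ≤ C1 * h := by
    rw [norm_sub_rev, ← hA lam]
    refine (Ai.le_opNorm c).trans ?_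
    rw [hC1, mul_assoc]
    gcongr
  have r2 : ‖u h - q h‖ ≤ C3 * h * h := by
    refine aux_mv_s8 (z := fun t => u t - q t) (fun t ht => (huv t ht).1.sub (hq t (hsub t ht)))
      (fun t ht => ?_) (by simp [hu0, hq0]) h hh'
    have h1 := (cu t ht).trans (hDt t ht)
    have h2 := (cq t ht).trans (hDt t ht)
    rw [Prod.mk_sub_mk, Prod.norm_mk, max_le_iff] at h1 h2
    have h3 : ‖v t - p t‖ ≤ 2 * D * h := by
      have := norm_sub_le (v t - p₀) (p t - p₀)
      rw [sub_sub_sub_cancel_right] at this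
      linarith [h1.2, h2.2]
    rw [← map_sub, hC3, mul_assoc]
    exact (N.le_opNorm _).trans (by gcongr)
  have r3 : ‖v h - p h‖ ≤ C2 * h * h := by
    refine aux_mv_s8 (z := fun t => v t - p t) (fun t ht => (huv t ht).2.sub (hp t (hsub t ht)))
      (fun t ht => ?_) (by simp [hv0, hp0]) h hh'
    have h1 := (cu t ht).trans (hDt t ht)
    have h2 := (cq t ht).trans (hDt t ht)
    have h5 := HΛ _ (h2.trans (by linarith))
    have h6 : KΛ * ‖(q t, p t) - (q₀, p₀)‖ ≤ KΛ * (D * h) := by gcongr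
    rw [Prod.mk_sub_mk, Prod.norm_mk, max_le_iff] at h1
    have h7 := (norm_fst_le _).trans h2
    have hDh : 0 ≤ D * h := by positivity
    have hCh : 0 ≤ C1 * h := by positivity
    have hKh : 0 ≤ KΛ * (D * h) := by positivity
    have f1 := fbd (u t) lam ((D + C1) * h) (by linarith [h1.1]) (by linarith) hh2
    have f2 := fbd (q t) (Λ (q t, p t)) ((D + KΛ * D) * h)
      (by rw [Prod.mk_sub_mk] at h7; simp only at h7; linarith) (by linarith) hh3
    have := norm_sub_le (f (u t, lam) - f (q₀, ls)) (f (q t, Λ (q t, p t)) - f (q₀, ls))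
    rw [sub_sub_sub_cancel_right] at this
    rw [hC2]; linarith
  have r4 : ‖fderiv ℝ g (u h) (N (v h))‖ ≤ 3 * (L * D) * h * h := by
    have h1 := s1 h hh'
    have h2 := norm_le_norm_add_norm_sub (h • c) (fderiv ℝ g (u h) (N (v h)))
    rw [norm_sub_rev, norm_smul, Real.norm_of_nonneg h0.le] at h2
    have : h * ‖c‖ ≤ h * (2 * (L * D) * h) := by gcongr
    linarith
  have hhh : 0 ≤ h * h := by positivity
  have p1 := mul_nonneg hC10 hhh
  have p2 := mul_nonneg hC20 hhh
  have p3 := mul_nonneg hC30 hhh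
  have p4 := mul_nonneg hLD hhh
  have p2' := mul_nonneg hC20 h0.le
  have p3' := mul_nonneg hC30 h0.le
  have p4' := mul_nonneg hLD h0.le
  refine ⟨by linarith, by linarith, by linarith, by linarith⟩

theorem gm_mulVec {m ν : ℕ} {g : (Fin m → ℝ) → (Fin ν → ℝ)} (hg : Differentiable ℝ g)
    (x w : Fin m → ℝ) : (gradMat g x)ᵀ *ᵥ w = fderiv ℝ g x w := by
  funext a
  have h1 : fderiv ℝ g x w a = fderiv ℝ (fun y => g y a) x w := by
    rw [fderiv_apply (hg x) a]; rfl
  rw [h1]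
  conv_rhs => rw [pi_eq_sum_univ' w, map_sum]
  simp only [Matrix.mulVec, dotProduct, gradMat, Matrix.transpose_apply, Matrix.of_apply, map_smul,
    smul_eq_mul]
  refine Finset.sum_congr rfl fun i _ => ?_
  rw [mul_comm]

theorem hv_eq {m ν : ℕ} {g : (Fin m → ℝ) → (Fin ν → ℝ)} (hg : ContDiff ℝ 3 g)
    (x v w : Fin m → ℝ) : hessVec g x v w = fderiv ℝ (fderiv ℝ g) x v w := by
  have hg1 : ContDiff ℝ 2 (fderiv ℝ g) := hg.fderiv_right (by norm_num)
  funext a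
  have h0 : (fun y => fderiv ℝ (fun z => g z a) y w)
      = fun y => ContinuousLinearMap.proj (R := ℝ) (φ := fun _ : Fin ν => ℝ) a (fderiv ℝ g y w) := by
    funext y
    rw [fderiv_apply (hg.differentiable (by norm_num) y) a]; rfl
  have h1 : HasFDerivAt (fderiv ℝ g) (fderiv ℝ (fderiv ℝ g) x) x :=
    ((hg1.differentiable (by norm_num)) x).hasFDerivAt
  have h2 := h1.clm_apply (hasFDerivAt_const w x)
  have h3 := (ContinuousLinearMap.proj (R := ℝ) (φ := fun _ : Fin ν => ℝ) a).hasFDerivAt.comp x h2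
  unfold hessVec
  rw [h0]
  have := h3.fderiv
  simp only [Function.comp_def] at this
  rw [this]
  simp

section
attribute [local instance] Matrix.linftyOpNormedAddCommGroup Matrix.linftyOpNormedSpace
  Matrix.linftyOpNormedRing Matrix.linftyOpNormedAlgebra

theorem inv_diff {X : Type*} [NormedAddCommGroup X] [NormedSpace ℝ X] {ν : ℕ}
    (A : X → Matrix (Fin ν) (Fin ν) ℝ) (b : X → Fin ν → ℝ) (x : X)
    (hA : ∀ i j, DifferentiableAt ℝ (fun x => A x i j) x) (hb : DifferentiableAt ℝ b x)
    (hu : IsUnit (A x)) : DifferentiableAt ℝ (fun x => (A x)⁻¹ *ᵥ b x) x := by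
  have hA' : DifferentiableAt ℝ A x := by
    have : A = fun x => ∑ i, ∑ j, A x i j • Matrix.single i j (1:ℝ) := by
      funext x
      conv_lhs => rw [Matrix.matrix_eq_sum_single (A x)]
      simp
    rw [this]
    exact DifferentiableAt.fun_sum fun i _ => DifferentiableAt.fun_sum fun j _ =>
      (hA i j).smul_const _
  obtain ⟨w, hw⟩ := hu
  have h1 : DifferentiableAt ℝ (fun x => (A x)⁻¹) x := by
    simp only [Matrix.nonsing_inv_eq_ringInverse]
    have := differentiableAt_inverse (𝕜 := ℝ) w.isUnit
    rw [hw] at this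
    exact this.comp x hA'
  rw [differentiableAt_pi]
  intro i
  simp only [Matrix.mulVec, dotProduct]
  have h2 : ∀ j, DifferentiableAt ℝ (fun x => (A x)⁻¹ i j) x := fun j => by
    let l : Matrix (Fin ν) (Fin ν) ℝ →ₗ[ℝ] ℝ :=
      { toFun := fun B => B i j, map_add' := fun _ _ => rfl, map_smul' := fun _ _ => rfl }
    exact (LinearMap.toContinuousLinearMap l).differentiableAt.comp x h1
  exact DifferentiableAt.fun_sum fun j _ => (h2 j).mul (differentiableAt_pi.1 hb j)
end




set_option maxHeartbeats 4000000 in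
theorem stmt8 {m ν : ℕ} (hmn : ν < m)
    (M : Matrix (Fin m) (Fin m) ℝ) (hM : M.PosDef)
    (U : (Fin m → ℝ) → ℝ) (hU : ∀ x, AnalyticAt ℝ U x)
    (g : (Fin m → ℝ) → (Fin ν → ℝ)) (hg : ∀ x, AnalyticAt ℝ g x)
    (q₀ p₀ : Fin m → ℝ)
    (hns : IsUnit ((gradMat g q₀)ᵀ * M⁻¹ * gradMat g q₀))
    (hg0 : g q₀ = 0)
    (hh0 : (gradMat g q₀)ᵀ *ᵥ (M⁻¹ *ᵥ p₀) = 0)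
    (T : ℝ) (hT : 0 < T)
    (q p : ℝ → Fin m → ℝ) (hq0 : q 0 = q₀) (hp0 : p 0 = p₀)
    (hq : ∀ t ∈ Set.Icc (0:ℝ) T, HasDerivAt q (M⁻¹ *ᵥ p t) t)
    (hp : ∀ t ∈ Set.Icc (0:ℝ) T,
      HasDerivAt p (-(grad U (q t) + gradMat g (q t) *ᵥ lagMult M U g (q t) (p t))) t)
    (hcon : ∀ t ∈ Set.Icc (0:ℝ) T, g (q t) = 0) :
    ∃ C > 0, ∃ r > 0, ∃ h₀ > 0, h₀ ≤ T ∧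
      ∀ h ∈ Set.Ioc (0:ℝ) h₀,
        ∀ lam : Fin ν → ℝ, ‖lam - lagMult M U g q₀ p₀‖ ≤ r →
          ∀ u v : ℝ → Fin m → ℝ, u 0 = q₀ → v 0 = p₀ →
            (∀ t ∈ Set.Icc (0:ℝ) h, HasDerivAt u (M⁻¹ *ᵥ v t) t ∧
              HasDerivAt v (-(grad U (u t) + gradMat g (u t) *ᵥ lam)) t) →
            g (u h) = 0 →
            ‖lam - lagMult M U g q₀ p₀‖ ≤ C * h ∧
            ‖u h - q h‖ ≤ C * h ^ 2 ∧
            ‖v h - p h‖ ≤ C * h ^ 2 ∧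
            ‖(gradMat g (u h))ᵀ *ᵥ (M⁻¹ *ᵥ v h)‖ ≤ C * h ^ 2 := by
    classical
  have hg3 : ContDiff ℝ 3 g := contDiff_iff_contDiffAt.2 fun x => (hg x).contDiffAt
  have hU3 : ContDiff ℝ 3 U := contDiff_iff_contDiffAt.2 fun x => (hU x).contDiffAt
  have hgd : Differentiable ℝ g := hg3.differentiable (by norm_num)
  have hg1 : ContDiff ℝ 2 (fderiv ℝ g) := hg3.fderiv_right (by norm_num)
  have hg2 : ContDiff ℝ 1 (fderiv ℝ (fderiv ℝ g)) := hg1.fderiv_right (by norm_num)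
  have hgU : ContDiff ℝ 1 (grad U) := by
    have : ContDiff ℝ 1 (fderiv ℝ U) := hU3.fderiv_right (by norm_num)
    exact contDiff_pi.2 fun i => this.clm_apply contDiff_const
  have hgm : ∀ i a, ContDiff ℝ 1 (fun x => gradMat g x i a) := by
    intro i a
    have h1 : ContDiff ℝ 3 (fun x => g x a) := by fun_prop
    have : ContDiff ℝ 1 (fderiv ℝ (fun x => g x a)) := h1.fderiv_right (by norm_num)
    exact this.clm_apply contDiff_const
  let N : (Fin m → ℝ) →L[ℝ] (Fin m → ℝ) := LinearMap.toContinuousLinearMap (Matrix.mulVecLin M⁻¹)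
  have hN : ∀ w, N w = M⁻¹ *ᵥ w := fun w => rfl
  set A := (gradMat g q₀)ᵀ * M⁻¹ * gradMat g q₀ with hA
  let Ai : (Fin ν → ℝ) →L[ℝ] (Fin ν → ℝ) := LinearMap.toContinuousLinearMap (Matrix.mulVecLin A⁻¹)
  have hAi : ∀ w, Ai w = A⁻¹ *ᵥ w := fun w => rfl
  have key := core N (fun z => -(grad U z.1 + gradMat g z.1 *ᵥ z.2)) g
    (fun z => lagMult M U g z.1 z.2) q₀ p₀ hg3 ?_ ?_ Ai hg0 ?_ ?_ T hT q p hq0 hp0 hq hp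
  · simpa only [gm_mulVec hgd, ← hN] using key
  · refine (ContDiff.add (by fun_prop) ?_).neg
    rw [contDiff_pi]
    intro i
    simp only [Matrix.mulVec, dotProduct]
    have := fun a => (hgm i a).comp (contDiff_fst (𝕜 := ℝ) (n := 1) (E := Fin m → ℝ) (F := Fin ν → ℝ))
    simp only [Function.comp_def] at this
    fun_prop
  · refine inv_diff (fun z : (Fin m → ℝ) × (Fin m → ℝ) => (gradMat g z.1)ᵀ * M⁻¹ * gradMat g z.1)
      _ (q₀, p₀) ?_ ?_ hns
    · intro i j
      have h : ∀ i a, DifferentiableAt ℝ (fun z : (Fin m → ℝ) × (Fin m → ℝ) => gradMat g z.1 i a) (q₀, p₀) :=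
        fun i a => (((hgm i a).comp contDiff_fst).differentiable (by norm_num)).differentiableAt
      simp only [Matrix.mul_apply, Matrix.transpose_apply]
      fun_prop
    · simp only [hv_eq hg3, gm_mulVec hgd, ← hN]
      have e1 : Differentiable ℝ (fderiv ℝ (fderiv ℝ g)) := hg2.differentiable (by norm_num)
      have e2 : Differentiable ℝ (fderiv ℝ g) := hg1.differentiable (by norm_num)
      have e3 : Differentiable ℝ (grad U) := hgU.differentiable (by norm_num)
      fun_prop
  · rw [← gm_mulVec hgd, hN, hh0]
  · intro l
    have hdet : IsUnit A.det := (Matrix.isUnit_iff_isUnit_det A).1 hns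
    have h1 : l = A⁻¹ *ᵥ (A *ᵥ l) := by
      rw [Matrix.mulVec_mulVec, Matrix.nonsing_inv_mul _ hdet, Matrix.one_mulVec]
    simp only [lagMult]
    rw [← hA]
    conv_rhs => rw [h1]
    rw [← Matrix.mulVec_sub, hAi]
    congr 1
    rw [← hv_eq hg3, ← gm_mulVec hgd]
    simp only [hN, Matrix.mulVec_neg, Matrix.mulVec_add, hA, Matrix.mulVec_mulVec, Matrix.mul_assoc]
    abel
end

section
/- Assume U and g are real-analytic, and let (q, p) : [0,T] → ℝ^m × ℝ^m be the exact solution of the constrained system (q̇ = M⁻¹p, ṗ = −∇U(q) − ∇g(q)·λ(q,p), g(q(t)) = 0) with ∇g(q(t))ᵀM⁻¹∇g(q(t)) nonsingular for all t ∈ [0,T]. Fix t* ∈ [0,T) and K > 0. Then there exist h₀ > 0, r > 0 and C > 0 such that for every h ∈ (0, h₀] with t* + h ≤ T and every (q_n, p_n) ∈ ℝ^m × ℝ^m satisfying ‖q_n − q(t*)‖ ≤ K·h, ‖p_n − p(t*)‖ ≤ K·h, g(q_n) = 0, ∇g(q_n)ᵀM⁻¹∇g(q_n) nonsingular and ‖∇g(q_n)ᵀM⁻¹p_n‖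 ≤ K·h², there is a unique λ_n ∈ ℝ^ν with ‖λ_n − λ(q(t*), p(t*))‖ ≤ r such that the solution (u, v) of u̇ = M⁻¹v, v̇ = −∇U(u) − ∇g(u)λ_n, u(0) = q_n, v(0) = p_n exists on [0,h] and satisfies g(u(h)) = 0; moreover then H(u(h), v(h)) = H(q_n, p_n), ‖λ_n − λ(q(t*), p(t*))‖ ≤ C·h, ‖u(h) − q(t*+h)‖ ≤ C·h, ‖v(h) − p(t*+h)‖ ≤ C·h, and ‖∇g(u(h))ᵀM⁻¹v(h)‖ ≤ C·h². -/
open MeasureTheory Matrix Set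

section Core

set_option linter.unusedSectionVars false

variable {V Λ : Type*} [NormedAddCommGroup V] [NormedSpace ℝ V] [CompleteSpace V]
  [NormedAddCommGroup Λ] [NormedSpace ℝ Λ] [CompleteSpace Λ]

/-- Abstract quantitative hypotheses for the one-step analysis. -/
structure CoreHyp (f : V → Λ → V) (F : V → Λ) (A : V → Λ →L[ℝ] Λ) (gg ww : V → Λ)
    (xs : V) (ls : Λ) (L : ℝ) : Prop where
  hL : 1 ≤ L
  bound : ∀ y, ‖y - xs‖ ≤ 2 → ∀ l, ‖l - ls‖ ≤ 1 → ‖f y l‖ ≤ L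
  lip : ∀ y₁, ‖y₁ - xs‖ ≤ 2 → ∀ y₂, ‖y₂ - xs‖ ≤ 2 → ∀ l₁, ‖l₁ - ls‖ ≤ 1 → ∀ l₂, ‖l₂ - ls‖ ≤ 1 →
    ‖f y₁ l₁ - f y₂ l₂‖ ≤ L * ‖y₁ - y₂‖ + L * ‖l₁ - l₂‖
  lipF : ∀ y₁, ‖y₁ - xs‖ ≤ 2 → ∀ y₂, ‖y₂ - xs‖ ≤ 2 → ‖F y₁ - F y₂‖ ≤ L * ‖y₁ - y₂‖
  lipA : ∀ y₁, ‖y₁ - xs‖ ≤ 2 → ∀ y₂, ‖y₂ - xs‖ ≤ 2 → ‖A y₁ - A y₂‖ ≤ L * ‖y₁ - y₂‖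
  eqs : F xs = A xs ls
  dg : ∀ (y : ℝ → V) (l : Λ) (t : ℝ), HasDerivAt y (f (y t) l) t →
    HasDerivAt (fun s => gg (y s)) (ww (y t)) t
  dw : ∀ (y : ℝ → V) (l : Λ) (t : ℝ), HasDerivAt y (f (y t) l) t →
    HasDerivAt (fun s => ww (y s)) (F (y t) - A (y t) l) t

theorem second_order_bound {z z' z'' : ℝ → Λ} {h a B : ℝ} (hh : 0 ≤ h)
    (h1 : ∀ t ∈ Icc (0:ℝ) h, HasDerivAt z (z' t) t)
    (h2 : ∀ t ∈ Icc (0:ℝ) h, HasDerivAt z' (z'' t) t)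
    (hB : ∀ t ∈ Icc (0:ℝ) h, ‖z'' t‖ ≤ B) (ha : ‖z' 0‖ ≤ a) (h0 : z 0 = 0) (hB0 : 0 ≤ B) :
    ‖z h‖ ≤ (a + B * h) * h ∧ ‖z' h‖ ≤ a + B * h := by
  have k2 : ∀ t ∈ Icc (0:ℝ) h, ‖z' t‖ ≤ a + B * h := by
    intro t ht
    have := norm_image_sub_le_of_norm_deriv_le_segment' (f := z') (f' := z'') (C := B)
      (fun x hx => (h2 x hx).hasDerivWithinAt) (fun x hx => hB x (Ico_subset_Icc_self hx)) t ht
    have e : z' t = (z' t - z' 0) + z' 0 := by abel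
    rw [e]
    refine (norm_add_le _ _).trans ?_
    have : B * (t - 0) ≤ B * h := by
      apply mul_le_mul_of_nonneg_left _ hB0; linarith [ht.2]
    linarith
  have hm : h ∈ Icc (0:ℝ) h := ⟨hh, le_rfl⟩
  refine ⟨?_, k2 h hm⟩
  have := norm_image_sub_le_of_norm_deriv_le_segment' (f := z) (f' := z') (C := a + B * h)
      (fun x hx => (h1 x hx).hasDerivWithinAt) (fun x hx => k2 x (Ico_subset_Icc_self hx)) h hm
  simpa [h0] using this

variable {f : V → Λ → V} {F : V → Λ} {A : V → Λ →L[ℝ] Λ} {gg ww : V → Λ}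
    {xs : V} {ls : Λ} {L : ℝ}


theorem CoreHyp.apriori (H : CoreHyp f F A gg ww xs ls L) {y : ℝ → V} {l : Λ} {h : ℝ}
    (hh : (L + 1) * h ≤ 1) (hl : ‖l - ls‖ ≤ 1) (h0 : ‖y 0 - xs‖ ≤ 1)
    (hy : ∀ t ∈ Icc (0:ℝ) h, HasDerivAt y (f (y t) l) t) :
    ∀ t ∈ Icc (0:ℝ) h, ‖y t - y 0‖ ≤ (L + 1) * t := by
  have hL := H.hL
  intro t ht
  refine image_norm_le_of_norm_deriv_right_lt_deriv_boundary (f := fun t => y t - y 0)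
    (f' := fun t => f (y t) l) (B := fun t => (L + 1) * t) (B' := fun _ => L + 1)
    (a := 0) (b := h) ?_ ?_ ?_ ?_ ?_ ht
  · intro x hx
    exact ((hy x hx).continuousAt.sub continuousAt_const).continuousWithinAt
  · intro x hx
    exact ((hy x (Ico_subset_Icc_self hx)).sub_const _).hasDerivWithinAt
  · simp
  · intro x
    simpa using (hasDerivAt_id x).const_mul (L + 1)
  · intro x hx hb
    have : ‖f (y x) l‖ ≤ L := by
      apply H.bound _ _ _ hl
      have e : y x - xs = (y x - y 0) + (y 0 - xs) := by abel
      rw [e]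
      refine (norm_add_le _ _).trans ?_
      have : (L + 1) * x ≤ (L + 1) * h := mul_le_mul_of_nonneg_left hx.2.le (by linarith)
      linarith
    linarith


theorem CoreHyp.apriori' (H : CoreHyp f F A gg ww xs ls L) {y : ℝ → V} {l : Λ} {h K : ℝ}
    (hh : (L + 1) * h ≤ 1) (hK : K * h ≤ 1) (hl : ‖l - ls‖ ≤ 1) (h0 : ‖y 0 - xs‖ ≤ K * h)
    (hy : ∀ t ∈ Icc (0:ℝ) h, HasDerivAt y (f (y t) l) t) :
    ∀ t ∈ Icc (0:ℝ) h, ‖y t - xs‖ ≤ (L + 1 + K) * h ∧ ‖y t - xs‖ ≤ 2 := by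
  intro t ht
  have hL := H.hL
  have := H.apriori hh hl (h0.trans hK) hy t ht
  have e : y t - xs = (y t - y 0) + (y 0 - xs) := by abel
  rw [e]
  have := norm_add_le (y t - y 0) (y 0 - xs)
  have : (L + 1) * t ≤ (L + 1) * h := mul_le_mul_of_nonneg_left ht.2 (by linarith)
  constructor <;> linarith


theorem CoreHyp.compare (H : CoreHyp f F A gg ww xs ls L) {y₁ y₂ : ℝ → V} {l₁ l₂ : Λ} {h K : ℝ}
    (hh : (L + 1) * h ≤ 1) (hK : K * h ≤ 1) (hl₁ : ‖l₁ - ls‖ ≤ 1) (hl₂ : ‖l₂ - ls‖ ≤ 1)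
    (h0 : ‖y₁ 0 - xs‖ ≤ K * h) (h00 : y₂ 0 = y₁ 0)
    (hy₁ : ∀ t ∈ Icc (0:ℝ) h, HasDerivAt y₁ (f (y₁ t) l₁) t)
    (hy₂ : ∀ t ∈ Icc (0:ℝ) h, HasDerivAt y₂ (f (y₂ t) l₂) t) :
    ∀ t ∈ Icc (0:ℝ) h, ‖y₁ t - y₂ t‖ ≤ 2 * L * h * ‖l₁ - l₂‖ := by
  intro t ht
  have hL := H.hL
  have a1 := H.apriori' hh hK hl₁ h0 hy₁
  have a2 := H.apriori' hh hK hl₂ (h00 ▸ h0) hy₂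
  have := norm_le_gronwallBound_of_norm_deriv_right_le (f := fun t => y₁ t - y₂ t)
    (f' := fun t => f (y₁ t) l₁ - f (y₂ t) l₂) (δ := 0) (K := L) (ε := L * ‖l₁ - l₂‖)
    (a := 0) (b := h)
    (fun x hx => ((hy₁ x hx).continuousAt.sub (hy₂ x hx).continuousAt).continuousWithinAt)
    (fun x hx => ((hy₁ x (Ico_subset_Icc_self hx)).sub
      (hy₂ x (Ico_subset_Icc_self hx))).hasDerivWithinAt)
    (by simp [h00])
    (fun x hx => H.lip _ (a1 x (Ico_subset_Icc_self hx)).2 _ (a2 x (Ico_subset_Icc_self hx)).2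
      _ hl₁ _ hl₂) t ht
  refine this.trans ?_
  rw [gronwallBound_of_K_ne_0 (by linarith)]
  have hLt0 : 0 ≤ L * t := mul_nonneg (by linarith) ht.1
  have hLt : L * t ≤ L * h := mul_le_mul_of_nonneg_left ht.2 (by linarith)
  have h0' : 0 ≤ h := ht.1.trans ht.2
  have hLt1 : L * t ≤ 1 := by linarith
  have e := Real.abs_exp_sub_one_le (x := L * t) (by rw [abs_of_nonneg hLt0]; exact hLt1)
  rw [abs_of_nonneg hLt0] at e
  have e2 := (le_abs_self _).trans e
  have hne : L ≠ 0 := by linarith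
  simp only [zero_mul, zero_add, sub_zero]
  rw [mul_div_cancel_left₀ _ hne, mul_comm (2 * L * h)]
  apply mul_le_mul_of_nonneg_left _ (norm_nonneg _)
  linarith


theorem CoreHyp.diff (H : CoreHyp f F A gg ww xs ls L) {y₁ y₂ : ℝ → V} {l₁ l₂ : Λ} {h K : ℝ}
    (hpos : 0 < h) (hK0 : 0 < K)
    (hh : (L + 1) * h ≤ 1) (hK : K * h ≤ 1) (hl₁ : ‖l₁ - ls‖ ≤ 1) (hl₂ : ‖l₂ - ls‖ ≤ 1)
    (h0 : ‖y₁ 0 - xs‖ ≤ K * h) (h00 : y₂ 0 = y₁ 0)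
    (hy₁ : ∀ t ∈ Icc (0:ℝ) h, HasDerivAt y₁ (f (y₁ t) l₁) t)
    (hy₂ : ∀ t ∈ Icc (0:ℝ) h, HasDerivAt y₂ (f (y₂ t) l₂) t) :
    ‖gg (y₁ h) - gg (y₂ h) + (h ^ 2 / 2) • A xs (l₁ - l₂)‖ ≤
      (2 * L ^ 2 + 2 * L ^ 2 * (‖ls‖ + 1) + L * (L + 1 + K)) * h ^ 3 * ‖l₁ - l₂‖ := by
  have hL := H.hL
  have a1 := H.apriori' hh hK hl₁ h0 hy₁
  have a2 := H.apriori' hh hK hl₂ (h00 ▸ h0) hy₂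
  have cmp := H.compare hh hK hl₁ hl₂ h0 h00 hy₁ hy₂
  set C := (2 * L ^ 2 + 2 * L ^ 2 * (‖ls‖ + 1) + L * (L + 1 + K)) with hC
  have hC0 : 0 ≤ C := by positivity
  have := second_order_bound (z := fun t => gg (y₁ t) - gg (y₂ t) + (t ^ 2 / 2) • A xs (l₁ - l₂))
    (z' := fun t => ww (y₁ t) - ww (y₂ t) + t • A xs (l₁ - l₂))
    (z'' := fun t => (F (y₁ t) - A (y₁ t) l₁) - (F (y₂ t) - A (y₂ t) l₂) + A xs (l₁ - l₂))
    (h := h) (a := 0) (B := C * h * ‖l₁ - l₂‖) hpos.le ?_ ?_ ?_ ?_ ?_ ?_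
  · refine this.1.trans (le_of_eq ?_)
    ring
  · intro t ht
    refine ((H.dg _ _ _ (hy₁ t ht)).sub (H.dg _ _ _ (hy₂ t ht))).add ?_
    have : HasDerivAt (fun t : ℝ => t ^ 2 / 2) t t := by
      have := ((hasDerivAt_id t).pow 2).div_const 2
      simpa using this
    exact this.smul_const _
  · intro t ht
    refine ((H.dw _ _ _ (hy₁ t ht)).sub (H.dw _ _ _ (hy₂ t ht))).add ?_
    simpa using (hasDerivAt_id t).smul_const (A xs (l₁ - l₂))
  · intro t ht
    have e : (F (y₁ t) - A (y₁ t) l₁) - (F (y₂ t) - A (y₂ t) l₂) + A xs (l₁ - l₂)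
      = (F (y₁ t) - F (y₂ t)) - (A (y₁ t) - A (y₂ t)) l₁ - (A (y₂ t) - A xs) (l₁ - l₂) := by
      simp only [_root_.sub_apply, map_sub]; abel
    rw [e]
    have b1 := H.lipF _ (a1 t ht).2 _ (a2 t ht).2
    have b2 := H.lipA _ (a1 t ht).2 _ (a2 t ht).2
    have b3 := H.lipA _ (a2 t ht).2 xs (by simp)
    have hn : ‖l₁‖ ≤ ‖ls‖ + 1 := by
      have e : l₁ = (l₁ - ls) + ls := by abel
      have := norm_add_le (l₁ - ls) ls
      rw [← e] at this; linarith
    set d := ‖l₁ - l₂‖ with hd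
    have hd0 : 0 ≤ d := norm_nonneg _
    have c1 : ‖F (y₁ t) - F (y₂ t)‖ ≤ L * (2 * L * h * d) :=
      b1.trans (mul_le_mul_of_nonneg_left (cmp t ht) (by linarith))
    have c2 : ‖(A (y₁ t) - A (y₂ t)) l₁‖ ≤ (L * (2 * L * h * d)) * (‖ls‖ + 1) := by
      refine (ContinuousLinearMap.le_opNorm _ _).trans ?_
      have := b2.trans (mul_le_mul_of_nonneg_left (cmp t ht) (by linarith : 0 ≤ L))
      gcongr
    have c3 : ‖(A (y₂ t) - A xs) (l₁ - l₂)‖ ≤ (L * ((L + 1 + K) * h)) * d := by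
      refine (ContinuousLinearMap.le_opNorm _ _).trans ?_
      have := b3.trans (mul_le_mul_of_nonneg_left (a2 t ht).1 (by linarith : 0 ≤ L))
      gcongr
    refine (norm_sub_le _ _).trans ?_
    have := norm_sub_le (F (y₁ t) - F (y₂ t)) ((A (y₁ t) - A (y₂ t)) l₁)
    have e3 : C * h * d = L * (2 * L * h * d) + (L * (2 * L * h * d)) * (‖ls‖ + 1)
      + (L * ((L + 1 + K) * h)) * d := by rw [hC]; ring
    rw [e3]; linarith
  · simp [h00]
  · simp [h00]
  · positivity

/-- residual estimate -/
theorem CoreHyp.resid (H : CoreHyp f F A gg ww xs ls L) {y : ℝ → V} {l : Λ} {h K c : ℝ}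
    (hpos : 0 < h) (hK0 : 0 < K) (hc : 0 ≤ c)
    (hh : (L + 1) * h ≤ 1) (hK : K * h ≤ 1) (hl : ‖l - ls‖ ≤ 1) (hlc : ‖l - ls‖ ≤ c * h)
    (h0 : ‖y 0 - xs‖ ≤ K * h) (hg0 : gg (y 0) = 0) (hw0 : ‖ww (y 0)‖ ≤ K * h ^ 2)
    (hy : ∀ t ∈ Icc (0:ℝ) h, HasDerivAt y (f (y t) l) t) :
    ‖gg (y h)‖ ≤ (K + (L * (L + 1 + K) * (‖ls‖ + 2) + ‖A xs‖ * c)) * h ^ 3 ∧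
    ‖ww (y h)‖ ≤ (K + (L * (L + 1 + K) * (‖ls‖ + 2) + ‖A xs‖ * c)) * h ^ 2 := by
  have hL := H.hL
  have a1 := H.apriori' hh hK hl h0 hy
  set C := (L * (L + 1 + K) * (‖ls‖ + 2) + ‖A xs‖ * c) with hC
  have hC0 : 0 ≤ C := by positivity
  have := second_order_bound (z := fun t => gg (y t)) (z' := fun t => ww (y t))
    (z'' := fun t => F (y t) - A (y t) l) (h := h) (a := K * h ^ 2) (B := C * h) hpos.le
    (fun t ht => H.dg _ _ _ (hy t ht)) (fun t ht => H.dw _ _ _ (hy t ht)) ?_ hw0 hg0 (by positivity)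
  · refine ⟨this.1.trans (le_of_eq (by ring)), this.2.trans (le_of_eq (by ring))⟩
  · intro t ht
    have e : F (y t) - A (y t) l = (F (y t) - F xs) - (A (y t) - A xs) l - A xs (l - ls) := by
      rw [H.eqs]
      simp only [_root_.sub_apply, map_sub]; abel
    have hn : ‖l‖ ≤ ‖ls‖ + 1 := by
      have e : l = (l - ls) + ls := by abel
      have := norm_add_le (l - ls) ls
      rw [← e] at this; linarith
    have hLK : ‖y t - xs‖ ≤ (L + 1 + K) * h := (a1 t ht).1
    have c1 : ‖F (y t) - F xs‖ ≤ L * ((L + 1 + K) * h) :=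
      (H.lipF _ (a1 t ht).2 xs (by simp)).trans
        (mul_le_mul_of_nonneg_left hLK (by linarith))
    have c2 : ‖(A (y t) - A xs) l‖ ≤ (L * ((L + 1 + K) * h)) * (‖ls‖ + 1) := by
      refine (ContinuousLinearMap.le_opNorm _ _).trans ?_
      have := (H.lipA _ (a1 t ht).2 xs (by simp)).trans
        (mul_le_mul_of_nonneg_left hLK (by linarith))
      gcongr
    have c3 : ‖A xs (l - ls)‖ ≤ ‖A xs‖ * (c * h) := by
      refine (ContinuousLinearMap.le_opNorm _ _).trans ?_
      gcongr
    simp only [e]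
    refine (norm_sub_le _ _).trans ?_
    have := norm_sub_le (F (y t) - F xs) ((A (y t) - A xs) l)
    have e3 : C * h = L * ((L + 1 + K) * h) + (L * ((L + 1 + K) * h)) * (‖ls‖ + 1)
      + ‖A xs‖ * (c * h) := by rw [hC]; ring
    rw [e3]; linarith

theorem CoreHyp.exists_sol (H : CoreHyp f F A gg ww xs ls L) {y0 : V} {l : Λ} {h : ℝ}
    (hpos : 0 < h) (hh : (2 * L + 2) * h ≤ 1) (hl : ‖l - ls‖ ≤ 1) (h0 : ‖y0 - xs‖ ≤ 1) :
    ∃ y : ℝ → V, y 0 = y0 ∧ ∀ t ∈ Icc (0:ℝ) h, HasDerivAt y (f (y t) l) t := by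
  have hL := H.hL
  have hL0 : 0 ≤ L := by linarith
  have hP : IsPicardLindelof (fun _ y => f y l) (tmin := -(2 * h)) (tmax := 2 * h)
      ⟨0, by constructor <;> linarith⟩ xs 2 1 ⟨L, hL0⟩ ⟨L, hL0⟩ := by
    apply IsPicardLindelof.of_time_independent
    · intro x hx
      exact H.bound _ (by simpa [dist_eq_norm] using hx) _ hl
    · apply LipschitzOnWith.of_dist_le_mul
      intro x hx y hy
      have := H.lip _ (by simpa [dist_eq_norm] using hx) _ (by simpa [dist_eq_norm] using hy)
        l hl l hl
      rw [dist_eq_norm, dist_eq_norm]; change _ ≤ L * _; simpa using this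
    · simp only [sub_zero, zero_sub, neg_neg, max_self]
      change L * (2 * h) ≤ 2 - 1
      nlinarith
  obtain ⟨y, hy0, hy⟩ := hP.exists_eq_forall_mem_Icc_hasDerivWithinAt (x := y0)
    (by simpa [dist_eq_norm] using h0)
  refine ⟨y, hy0, fun t ht => (hy t ⟨by linarith [ht.1], by linarith [ht.2]⟩).hasDerivAt ?_⟩
  exact Icc_mem_nhds (by linarith [ht.1]) (by linarith [ht.2])

theorem CoreHyp.main (H : CoreHyp f F A gg ww xs ls L) (B : Λ →L[ℝ] Λ)
    (hBA : ∀ l, B (A xs l) = l) (hAB : ∀ l, A xs (B l) = l) {K : ℝ} (hK0 : 0 < K) :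
    ∃ h₀ > 0, ∃ C > 0, ∀ h ∈ Ioc (0:ℝ) h₀, ∀ y0 : V, ‖y0 - xs‖ ≤ K * h → gg y0 = 0 →
      ‖ww y0‖ ≤ K * h ^ 2 →
      (∃ l, ‖l - ls‖ ≤ 1 ∧ ∃ y : ℝ → V, y 0 = y0 ∧
        (∀ t ∈ Icc (0:ℝ) h, HasDerivAt y (f (y t) l) t) ∧ gg (y h) = 0) ∧
      (∀ l₁ l₂, ‖l₁ - ls‖ ≤ 1 → ‖l₂ - ls‖ ≤ 1 → ∀ y₁ y₂ : ℝ → V, y₁ 0 = y0 → y₂ 0 = y0 →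
        (∀ t ∈ Icc (0:ℝ) h, HasDerivAt y₁ (f (y₁ t) l₁) t) →
        (∀ t ∈ Icc (0:ℝ) h, HasDerivAt y₂ (f (y₂ t) l₂) t) →
        gg (y₁ h) = 0 → gg (y₂ h) = 0 → l₁ = l₂) ∧
      (∀ l, ‖l - ls‖ ≤ 1 → ∀ y : ℝ → V, y 0 = y0 →
        (∀ t ∈ Icc (0:ℝ) h, HasDerivAt y (f (y t) l) t) → gg (y h) = 0 →
        ‖l - ls‖ ≤ C * h ∧ ‖y h - xs‖ ≤ C * h ∧ ‖ww (y h)‖ ≤ C * h ^ 2) := by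
  have hL := H.hL
  have hL0 : 0 < L := by linarith
  obtain ⟨C₃, hC₃⟩ : ∃ C₃, C₃ = (2 * L ^ 2 + 2 * L ^ 2 * (‖ls‖ + 1) + L * (L + 1 + K)) := ⟨_, rfl⟩
  have hC₃0 : 0 < C₃ := by rw [hC₃]; positivity
  obtain ⟨C₄, hC₄⟩ : ∃ C₄, C₄ = (K + (L * (L + 1 + K) * (‖ls‖ + 2) + ‖A xs‖ * 0)) := ⟨_, rfl⟩
  have hC₄0 : 0 < C₄ := by rw [hC₄]; positivity
  obtain ⟨b, hb⟩ : ∃ b, b = ‖B‖ + 1 := ⟨_, rfl⟩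
  have hb0 : 0 < b := by rw [hb]; positivity
  have hBb : ∀ x, ‖B x‖ ≤ b * ‖x‖ := fun x => (B.le_opNorm x).trans
    (mul_le_mul_of_nonneg_right (by linarith) (norm_nonneg _))
  obtain ⟨c, hc⟩ : ∃ c, c = 4 * b * C₄ := ⟨_, rfl⟩
  have hc0 : 0 < c := by rw [hc]; positivity
  obtain ⟨C₅, hC₅⟩ : ∃ C₅, C₅ = (K + (L * (L + 1 + K) * (‖ls‖ + 2) + ‖A xs‖ * c)) := ⟨_, rfl⟩
  have hC₅0 : 0 < C₅ := by rw [hC₅]; positivity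
  obtain ⟨Q, hQ⟩ : ∃ Q, Q = 2 * L + 2 + K + 4 * b * C₃ + c := ⟨_, rfl⟩
  have hbC : 0 < 4 * b * C₃ := by positivity
  have hQ0 : 0 < Q := by rw [hQ]; positivity
  refine ⟨1 / Q, by positivity, c + (L + 1 + K) + C₅, by positivity, ?_⟩
  rintro h ⟨hpos, hle⟩ y0 hy0 hg0 hw0
  have hQh : Q * h ≤ 1 := by
    rw [le_div_iff₀ hQ0] at hle; linarith
  have hLh : 0 < L * h := by positivity
  have hKh : 0 < K * h := by positivity
  have hbh : 0 < 4 * b * C₃ * h := by positivity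
  have hch : 0 < c * h := by positivity
  rw [hQ] at hQh
  have s1 : (L + 1) * h ≤ 1 := by linarith
  have s2 : (2 * L + 2) * h ≤ 1 := by linarith
  have s3 : K * h ≤ 1 := by linarith
  have s4 : 4 * b * C₃ * h ≤ 1 := by linarith
  have s5 : c * h ≤ 1 := by linarith
  -- the Newton-like map on solutions
  have key : ∀ l₁ l₂, ‖l₁ - ls‖ ≤ 1 → ‖l₂ - ls‖ ≤ 1 → ∀ y₁ y₂ : ℝ → V, y₁ 0 = y0 → y₂ 0 = y0 →
        (∀ t ∈ Icc (0:ℝ) h, HasDerivAt y₁ (f (y₁ t) l₁) t) →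
        (∀ t ∈ Icc (0:ℝ) h, HasDerivAt y₂ (f (y₂ t) l₂) t) →
        ‖(l₁ + (2 / h ^ 2) • B (gg (y₁ h))) - (l₂ + (2 / h ^ 2) • B (gg (y₂ h)))‖
          ≤ 1 / 2 * ‖l₁ - l₂‖ := by
    intro l₁ l₂ hl₁ hl₂ y₁ y₂ e₁ e₂ hy₁ hy₂
    have d := H.diff hpos hK0 s1 s3 hl₁ hl₂ (e₁ ▸ hy0) (e₂.trans e₁.symm) hy₁ hy₂
    rw [← hC₃] at d
    have e : (l₁ + (2 / h ^ 2) • B (gg (y₁ h))) - (l₂ + (2 / h ^ 2) • B (gg (y₂ h)))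
      = (2 / h ^ 2) • B (gg (y₁ h) - gg (y₂ h) + (h ^ 2 / 2) • A xs (l₁ - l₂)) := by
      rw [map_add, map_smul, hBA, smul_add, smul_smul, map_sub, smul_sub]
      have : (2 / h ^ 2) * (h ^ 2 / 2) = 1 := by field_simp
      rw [this, one_smul]; abel
    rw [e, norm_smul, Real.norm_of_nonneg (by positivity)]
    calc 2 / h ^ 2 * ‖B (gg (y₁ h) - gg (y₂ h) + (h ^ 2 / 2) • A xs (l₁ - l₂))‖
        ≤ 2 / h ^ 2 * (b * (C₃ * h ^ 3 * ‖l₁ - l₂‖)) := by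
          gcongr
          exact (hBb _).trans (by gcongr)
      _ = 1 / 2 * ((4 * b * C₃ * h) * ‖l₁ - l₂‖) := by field_simp; ring
      _ ≤ 1 / 2 * (1 * ‖l₁ - l₂‖) := by gcongr
      _ = 1 / 2 * ‖l₁ - l₂‖ := by ring
  have ex : ∀ l, ‖l - ls‖ ≤ 1 → ∃ y : ℝ → V, y 0 = y0 ∧
      ∀ t ∈ Icc (0:ℝ) h, HasDerivAt y (f (y t) l) t := fun l hl =>
    H.exists_sol hpos s2 hl (hy0.trans s3)
  choose! Y hY0 hY using ex
  have hls : ‖ls - ls‖ ≤ 1 := by simp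
  have base : ‖(2 / h ^ 2) • B (gg (Y ls h))‖ ≤ 1 / 2 * (c * h) := by
    have d := (H.resid (c := 0) hpos hK0 le_rfl s1 s3 hls (by simp) ((hY0 ls hls).symm ▸ hy0)
      ((hY0 ls hls).symm ▸ hg0) ((hY0 ls hls).symm ▸ hw0) (hY ls hls)).1
    rw [← hC₄] at d
    rw [norm_smul, Real.norm_of_nonneg (by positivity)]
    calc 2 / h ^ 2 * ‖B (gg (Y ls h))‖ ≤ 2 / h ^ 2 * (b * (C₄ * h ^ 3)) := by
          gcongr
          exact (hBb _).trans (by gcongr)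
      _ = 1 / 2 * (c * h) := by rw [hc]; field_simp; norm_num
  have lest : ∀ l, ‖l - ls‖ ≤ 1 → ∀ y : ℝ → V, y 0 = y0 →
      (∀ t ∈ Icc (0:ℝ) h, HasDerivAt y (f (y t) l) t) → 
      ‖l + (2 / h ^ 2) • B (gg (y h)) - ls‖ ≤ 1 / 2 * ‖l - ls‖ + 1 / 2 * (c * h) := by
    intro l hl y e hy
    have k := key l ls hl hls y (Y ls) e (hY0 ls hls) hy (hY ls hls)
    have e : l + (2 / h ^ 2) • B (gg (y h)) - ls = ((l + (2 / h ^ 2) • B (gg (y h))) -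
      (ls + (2 / h ^ 2) • B (gg (Y ls h)))) + (2 / h ^ 2) • B (gg (Y ls h)) := by abel
    rw [e]
    exact (norm_add_le _ _).trans (add_le_add k base)
  refine ⟨?_, ?_, ?_⟩
  · -- existence
    let N : Λ → Λ := fun l => l + (2 / h ^ 2) • B (gg (Y l h))
    have hmaps : MapsTo N (Metric.closedBall ls 1) (Metric.closedBall ls 1) := by
      intro l hl
      rw [Metric.mem_closedBall, dist_eq_norm] at hl ⊢
      have := lest l hl (Y l) (hY0 l hl) (hY l hl)
      refine this.trans ?_
      linarith
    have hcontr : ContractingWith (1 / 2) (hmaps.restrict N _ _) := by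
      refine ⟨by rw [← NNReal.coe_lt_coe]; norm_num, LipschitzWith.of_dist_le_mul ?_⟩
      rintro ⟨l₁, hl₁⟩ ⟨l₂, hl₂⟩
      rw [Metric.mem_closedBall, dist_eq_norm] at hl₁ hl₂
      have := key l₁ l₂ hl₁ hl₂ _ _ (hY0 _ hl₁) (hY0 _ hl₂) (hY _ hl₁) (hY _ hl₂)
      rw [Subtype.dist_eq, Subtype.dist_eq, dist_eq_norm, dist_eq_norm]
      simpa [N] using this
    obtain ⟨l, hl, hfix, -⟩ := hcontr.exists_fixedPoint' Metric.isClosed_closedBall.isComplete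
      hmaps (x := ls) (by simp) (edist_ne_top _ _)
    rw [Metric.mem_closedBall, dist_eq_norm] at hl
    refine ⟨l, hl, Y l, hY0 l hl, hY l hl, ?_⟩
    have h1 : (2 / h ^ 2) • B (gg (Y l h)) = 0 := by
      have : l + (2 / h ^ 2) • B (gg (Y l h)) = l := hfix
      simpa using this
    have h2 : B (gg (Y l h)) = 0 := by
      rcases smul_eq_zero.1 h1 with h3 | h3
      · exact absurd h3 (by positivity)
      · exact h3
    rw [← hAB (gg (Y l h)), h2, map_zero]
  · intro l₁ l₂ hl₁ hl₂ y₁ y₂ e₁ e₂ hy₁ hy₂ z₁ z₂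
    have := key l₁ l₂ hl₁ hl₂ y₁ y₂ e₁ e₂ hy₁ hy₂
    rw [z₁, z₂] at this
    simp only [map_zero, smul_zero, add_zero] at this
    have h3 : ‖l₁ - l₂‖ = 0 := le_antisymm (by linarith) (norm_nonneg _)
    exact sub_eq_zero.1 (norm_eq_zero.1 h3)
  · intro l hl y e hy z
    have h1 := lest l hl y e hy
    rw [z, map_zero, smul_zero, add_zero] at h1
    have h2 : ‖l - ls‖ ≤ c * h := by linarith
    have h3 := (H.apriori' s1 s3 hl (e.symm ▸ hy0) hy h ⟨hpos.le, le_rfl⟩).1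
    have h4 := (H.resid (c := c) hpos hK0 hc0.le s1 s3 hl h2 (e.symm ▸ hy0)
      (e.symm ▸ hg0) (e.symm ▸ hw0) hy).2
    rw [← hC₅] at h4
    have hLK0 : 0 < (L + 1 + K) * h := by positivity
    have hC5h : 0 < C₅ * h := by positivity
    have hh2 : 0 < (c + (L + 1 + K)) * h ^ 2 := by positivity
    refine ⟨?_, ?_, ?_⟩ <;> linarith

end Core

section Concrete

variable {m ν : ℕ}

theorem fderiv_eq_sum (φ : (Fin m → ℝ) → ℝ) (q w : Fin m → ℝ) :
    fderiv ℝ φ q w = ∑ i, fderiv ℝ φ q (Pi.single i 1) * w i := by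
  conv_lhs => rw [pi_eq_sum_univ' w]
  rw [map_sum]
  refine Finset.sum_congr rfl fun i _ => ?_
  rw [map_smul, smul_eq_mul, mul_comm]

theorem gradT_apply (g : (Fin m → ℝ) → (Fin ν → ℝ)) (q w : Fin m → ℝ) (a : Fin ν) :
    ((gradMat g q)ᵀ *ᵥ w) a = fderiv ℝ (fun x => g x a) q w := by
  rw [fderiv_eq_sum]
  simp [Matrix.mulVec, dotProduct, gradMat]

theorem grad_dot (φ : (Fin m → ℝ) → ℝ) (q w : Fin m → ℝ) :
    grad φ q ⬝ᵥ w = fderiv ℝ φ q w := by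
  rw [fderiv_eq_sum]
  simp [dotProduct, grad]

theorem contDiff_mulVec {X : Type*} [NormedAddCommGroup X] [NormedSpace ℝ X] {k l : ℕ}
    {n : WithTop ℕ∞}
    {A : X → Matrix (Fin k) (Fin l) ℝ} {v : X → Fin l → ℝ}
    (hA : ∀ i j, ContDiff ℝ n (fun x => A x i j)) (hv : ContDiff ℝ n v) :
    ContDiff ℝ n (fun x => A x *ᵥ v x) := by
  rw [contDiff_pi]
  intro i
  simp only [Matrix.mulVec, dotProduct]
  exact ContDiff.sum fun j _ => (hA i j).mul (contDiff_pi.1 hv j)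

theorem contDiff_matMul {X : Type*} [NormedAddCommGroup X] [NormedSpace ℝ X] {k l r : ℕ}
    {n : WithTop ℕ∞}
    {A : X → Matrix (Fin k) (Fin l) ℝ} {B : X → Matrix (Fin l) (Fin r) ℝ}
    (hA : ∀ i j, ContDiff ℝ n (fun x => A x i j)) (hB : ∀ i j, ContDiff ℝ n (fun x => B x i j)) :
    ∀ i j, ContDiff ℝ n (fun x => (A x * B x) i j) := by
  intro i j
  simp only [Matrix.mul_apply]
  exact ContDiff.sum fun s _ => (hA i s).mul (hB s j)

theorem cd_top {X Y : Type*} [NormedAddCommGroup X] [NormedSpace ℝ X]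
    [NormedAddCommGroup Y] [NormedSpace ℝ Y] [CompleteSpace Y]
    {φ : X → Y} (h : ∀ x, AnalyticAt ℝ φ x) : ContDiff ℝ 3 φ := by
  rw [contDiff_iff_contDiffAt]
  exact fun x => (h x).contDiffAt

theorem contDiff_fderiv_apply {φ : (Fin m → ℝ) → ℝ} (h : ContDiff ℝ 3 φ) (w : Fin m → ℝ) :
    ContDiff ℝ 2 (fun q => fderiv ℝ φ q w) :=
  (h.fderiv_right (m := 2) (by norm_num)).clm_apply contDiff_const

theorem contDiff_comp_g {g : (Fin m → ℝ) → (Fin ν → ℝ)} (hg : ∀ x, AnalyticAt ℝ g x) (a : Fin ν) :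
    ContDiff ℝ 3 (fun x => g x a) := contDiff_pi.1 (cd_top hg) a

theorem contDiff_gradMat {g : (Fin m → ℝ) → (Fin ν → ℝ)} (hg : ∀ x, AnalyticAt ℝ g x) (i : Fin m)
    (a : Fin ν) : ContDiff ℝ 1 (fun q => gradMat g q i a) :=
  (contDiff_fderiv_apply (contDiff_comp_g hg a) _).of_le (by norm_num)

theorem contDiff_grad {U : (Fin m → ℝ) → ℝ} (hU : ∀ x, AnalyticAt ℝ U x) :
    ContDiff ℝ 1 (fun q => grad U q) :=
  contDiff_pi.2 fun _ => (contDiff_fderiv_apply (cd_top hU) _).of_le (by norm_num)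

theorem hessVec_eq {g : (Fin m → ℝ) → (Fin ν → ℝ)} (hg : ∀ x, AnalyticAt ℝ g x)
    (q v w : Fin m → ℝ) (a : Fin ν) :
    hessVec g q v w a = fderiv ℝ (fderiv ℝ (fun y => g y a)) q v w := by
  have hd : DifferentiableAt ℝ (fderiv ℝ (fun y => g y a)) q :=
    (((contDiff_comp_g hg a).fderiv_right (m := 2) (by norm_num)).differentiable (by norm_num)) q
  unfold hessVec
  rw [fderiv_clm_apply hd (differentiableAt_const w)]
  simp

/-- vector field -/
noncomputable def vf (M : Matrix (Fin m) (Fin m) ℝ) (U : (Fin m → ℝ) → ℝ)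
    (g : (Fin m → ℝ) → (Fin ν → ℝ)) (y : (Fin m → ℝ) × (Fin m → ℝ)) (l : Fin ν → ℝ) :
    (Fin m → ℝ) × (Fin m → ℝ) :=
  (M⁻¹ *ᵥ y.2, -(grad U y.1 + gradMat g y.1 *ᵥ l))

noncomputable def cF (M : Matrix (Fin m) (Fin m) ℝ) (U : (Fin m → ℝ) → ℝ)
    (g : (Fin m → ℝ) → (Fin ν → ℝ)) (y : (Fin m → ℝ) × (Fin m → ℝ)) : Fin ν → ℝ :=
  hessVec g y.1 (M⁻¹ *ᵥ y.2) (M⁻¹ *ᵥ y.2) - (gradMat g y.1)ᵀ *ᵥ (M⁻¹ *ᵥ grad U y.1)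

noncomputable def cA (M : Matrix (Fin m) (Fin m) ℝ)
    (g : (Fin m → ℝ) → (Fin ν → ℝ)) (y : (Fin m → ℝ) × (Fin m → ℝ)) :
    (Fin ν → ℝ) →L[ℝ] (Fin ν → ℝ) :=
  LinearMap.toContinuousLinearMap
    (Matrix.mulVecLin ((gradMat g y.1)ᵀ * M⁻¹ * gradMat g y.1))

theorem cA_apply (M : Matrix (Fin m) (Fin m) ℝ)
    (g : (Fin m → ℝ) → (Fin ν → ℝ)) (y : (Fin m → ℝ) × (Fin m → ℝ)) (l : Fin ν → ℝ) :
    cA M g y l = ((gradMat g y.1)ᵀ * M⁻¹ * gradMat g y.1) *ᵥ l := rfl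

theorem contDiff_vf (M : Matrix (Fin m) (Fin m) ℝ) {U : (Fin m → ℝ) → ℝ}
    {g : (Fin m → ℝ) → (Fin ν → ℝ)} (hU : ∀ x, AnalyticAt ℝ U x) (hg : ∀ x, AnalyticAt ℝ g x) :
    ContDiff ℝ 1 (fun z : ((Fin m → ℝ) × (Fin m → ℝ)) × (Fin ν → ℝ) => vf M U g z.1 z.2) := by
  refine ContDiff.prodMk ?_ (ContDiff.neg (ContDiff.add ?_ ?_))
  · exact contDiff_mulVec (fun _ _ => contDiff_const) contDiff_fst.snd
  · exact (contDiff_grad hU).comp contDiff_fst.fst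
  · exact contDiff_mulVec (fun i j => (contDiff_gradMat hg i j).comp contDiff_fst.fst) contDiff_snd

theorem contDiff_cF (M : Matrix (Fin m) (Fin m) ℝ) {U : (Fin m → ℝ) → ℝ}
    {g : (Fin m → ℝ) → (Fin ν → ℝ)} (hU : ∀ x, AnalyticAt ℝ U x) (hg : ∀ x, AnalyticAt ℝ g x) :
    ContDiff ℝ 1 (cF M U g) := by
  have hM2 : ContDiff ℝ 1 (fun y : (Fin m → ℝ) × (Fin m → ℝ) => M⁻¹ *ᵥ y.2) :=
    contDiff_mulVec (fun _ _ => contDiff_const) contDiff_snd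
  refine ContDiff.sub ?_ ?_
  · rw [contDiff_pi]
    intro a
    simp only [hessVec_eq hg]
    have h2 : ContDiff ℝ 1 (fderiv ℝ (fderiv ℝ (fun y => g y a))) :=
      ((contDiff_comp_g hg a).fderiv_right (m := 2) (by norm_num)).fderiv_right (by norm_num)
    exact ((h2.comp contDiff_fst).clm_apply hM2).clm_apply hM2
  · refine contDiff_mulVec (fun i j => (contDiff_gradMat hg j i).comp contDiff_fst) ?_
    exact contDiff_mulVec (fun _ _ => contDiff_const) ((contDiff_grad hU).comp contDiff_fst)

theorem contDiff_cA (M : Matrix (Fin m) (Fin m) ℝ)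
    {g : (Fin m → ℝ) → (Fin ν → ℝ)} (hg : ∀ x, AnalyticAt ℝ g x) :
    ContDiff ℝ 1 (cA M g) := by
  rw [contDiff_clm_apply_iff]
  intro l
  simp only [cA_apply]
  refine contDiff_mulVec ?_ contDiff_const
  refine contDiff_matMul (contDiff_matMul ?_ fun _ _ => contDiff_const) ?_
  · exact fun i j => (contDiff_gradMat hg j i).comp contDiff_fst
  · exact fun i j => (contDiff_gradMat hg i j).comp contDiff_fst

theorem hasDerivAt_mulVec {k : ℕ} (A : Matrix (Fin k) (Fin m) ℝ) {v : ℝ → Fin m → ℝ}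
    {v' : Fin m → ℝ} {t : ℝ} (hv : HasDerivAt v v' t) :
    HasDerivAt (fun s => A *ᵥ v s) (A *ᵥ v') t :=
  (LinearMap.toContinuousLinearMap A.mulVecLin).hasFDerivAt.comp_hasDerivAt t hv

theorem deriv_comp_g {g : (Fin m → ℝ) → (Fin ν → ℝ)} (hg : ∀ x, AnalyticAt ℝ g x)
    {u : ℝ → Fin m → ℝ} {u' : Fin m → ℝ} {t : ℝ} (hu : HasDerivAt u u' t) :
    HasDerivAt (fun s => g (u s)) ((gradMat g (u t))ᵀ *ᵥ u') t := by
  rw [hasDerivAt_pi]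
  intro a
  rw [gradT_apply]
  have hd : DifferentiableAt ℝ (fun y => g y a) (u t) :=
    (contDiff_comp_g hg a).differentiable (by norm_num) _
  exact hd.hasFDerivAt.comp_hasDerivAt t hu

theorem deriv_ww (M : Matrix (Fin m) (Fin m) ℝ) (U : (Fin m → ℝ) → ℝ)
    {g : (Fin m → ℝ) → (Fin ν → ℝ)} (hg : ∀ x, AnalyticAt ℝ g x)
    {u v : ℝ → Fin m → ℝ} {l : Fin ν → ℝ} {t : ℝ} (hu : HasDerivAt u (M⁻¹ *ᵥ v t) t)
    (hv : HasDerivAt v (-(grad U (u t) + gradMat g (u t) *ᵥ l)) t) :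
    HasDerivAt (fun s => (gradMat g (u s))ᵀ *ᵥ (M⁻¹ *ᵥ v s))
      (cF M U g (u t, v t) - cA M g (u t, v t) l) t := by
  rw [hasDerivAt_pi]
  intro a
  simp only [gradT_apply]
  have hd : DifferentiableAt ℝ (fderiv ℝ (fun y => g y a)) (u t) :=
    (((contDiff_comp_g hg a).fderiv_right (m := 2) (by norm_num)).differentiable (by norm_num)) _
  have h1 := hd.hasFDerivAt.comp_hasDerivAt t hu
  have h2 := h1.clm_apply (hasDerivAt_mulVec M⁻¹ hv)
  refine h2.congr_deriv ?_
  change fderiv ℝ (fderiv ℝ fun y => g y a) (u t) (M⁻¹ *ᵥ v t) (M⁻¹ *ᵥ v t)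
    + fderiv ℝ (fun y => g y a) (u t) (M⁻¹ *ᵥ -(grad U (u t) + gradMat g (u t) *ᵥ l))
    = hessVec g (u t) (M⁻¹ *ᵥ v t) (M⁻¹ *ᵥ v t) a
      - ((gradMat g (u t))ᵀ *ᵥ (M⁻¹ *ᵥ grad U (u t))) a
      - (((gradMat g (u t))ᵀ * M⁻¹ * gradMat g (u t)) *ᵥ l) a
  rw [hessVec_eq hg, ← Matrix.mulVec_mulVec, ← Matrix.mulVec_mulVec, gradT_apply, gradT_apply,
    Matrix.mulVec_neg, Matrix.mulVec_add, map_neg, map_add]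
  ring

theorem coreHyp (M : Matrix (Fin m) (Fin m) ℝ) {U : (Fin m → ℝ) → ℝ}
    {g : (Fin m → ℝ) → (Fin ν → ℝ)} (hU : ∀ x, AnalyticAt ℝ U x) (hg : ∀ x, AnalyticAt ℝ g x)
    (qs ps : Fin m → ℝ) (hns : IsUnit ((gradMat g qs)ᵀ * M⁻¹ * gradMat g qs)) :
    ∃ L, CoreHyp (vf M U g) (cF M U g) (cA M g) (fun y => g y.1)
      (fun y => (gradMat g y.1)ᵀ *ᵥ (M⁻¹ *ᵥ y.2)) (qs, ps) (lagMult M U g qs ps) L := by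
  set xs : (Fin m → ℝ) × (Fin m → ℝ) := (qs, ps) with hxs
  set ls := lagMult M U g qs ps with hls
  have hK : IsCompact (Metric.closedBall xs 2 ×ˢ Metric.closedBall ls 1) :=
    (isCompact_closedBall _ _).prod (isCompact_closedBall _ _)
  have hKc : Convex ℝ (Metric.closedBall xs 2 ×ˢ Metric.closedBall ls 1) :=
    (convex_closedBall _ _).prod (convex_closedBall _ _)
  have hS : IsCompact (Metric.closedBall xs 2) := isCompact_closedBall _ _
  have hSc : Convex ℝ (Metric.closedBall xs 2) := convex_closedBall _ _
  obtain ⟨K₁, h₁⟩ := (contDiff_vf M hU hg).contDiffOn.exists_lipschitzOnWith one_ne_zero hKc hK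
  obtain ⟨K₂, h₂⟩ := (contDiff_cF M hU hg).contDiffOn.exists_lipschitzOnWith one_ne_zero hSc hS
  obtain ⟨K₃, h₃⟩ := (contDiff_cA M hg).contDiffOn.exists_lipschitzOnWith one_ne_zero hSc hS
  obtain ⟨K₄, h₄⟩ := hK.exists_bound_of_continuousOn (contDiff_vf M hU hg).continuous.continuousOn
  have hmem : ∀ y, ‖y - xs‖ ≤ 2 → y ∈ Metric.closedBall xs 2 := fun y hy => by
    rwa [Metric.mem_closedBall, dist_eq_norm]
  have hmem' : ∀ y, ‖y - ls‖ ≤ 1 → y ∈ Metric.closedBall ls 1 := fun y hy => by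
    rwa [Metric.mem_closedBall, dist_eq_norm]
  have p1 : (0:ℝ) ≤ K₁ := K₁.2
  have p2 : (0:ℝ) ≤ K₂ := K₂.2
  have p3 : (0:ℝ) ≤ K₃ := K₃.2
  have p4 : (0:ℝ) ≤ |K₄| := abs_nonneg _
  refine ⟨1 + K₁ + K₂ + K₃ + |K₄|, ?_, ?_, ?_, ?_, ?_, ?_, ?_, ?_⟩
  · linarith
  · intro y hy l hl
    have := h₄ (y, l) ⟨hmem y hy, hmem' l hl⟩
    have := le_abs_self K₄
    linarith
  · intro y₁ hy₁ y₂ hy₂ l₁ hl₁ l₂ hl₂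
    have := h₁.dist_le_mul (y₁, l₁) ⟨hmem _ hy₁, hmem' _ hl₁⟩ (y₂, l₂) ⟨hmem _ hy₂, hmem' _ hl₂⟩
    rw [dist_eq_norm, dist_eq_norm] at this
    refine this.trans ?_
    rw [← mul_add]
    apply mul_le_mul _ _ (norm_nonneg _) (by positivity)
    · linarith
    · rw [Prod.norm_def]
      exact max_le (by simp) (by simp)
  · intro y₁ hy₁ y₂ hy₂
    have := h₂.dist_le_mul _ (hmem _ hy₁) _ (hmem _ hy₂)
    rw [dist_eq_norm, dist_eq_norm] at this
    exact this.trans (mul_le_mul_of_nonneg_right (by linarith) (norm_nonneg _))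
  · intro y₁ hy₁ y₂ hy₂
    have := h₃.dist_le_mul _ (hmem _ hy₁) _ (hmem _ hy₂)
    rw [dist_eq_norm, dist_eq_norm] at this
    exact this.trans (mul_le_mul_of_nonneg_right (by linarith) (norm_nonneg _))
  · rw [cA_apply, hls, lagMult, Matrix.mulVec_mulVec, Matrix.mul_nonsing_inv _
      ((Matrix.isUnit_iff_isUnit_det _).1 hns), Matrix.one_mulVec]
    rfl
  · intro y l t hy
    exact deriv_comp_g hg hy.fst
  · intro y l t hy
    exact deriv_ww M U hg hy.fst hy.snd

theorem hasDerivAt_dot {v w : ℝ → Fin m → ℝ} {v' w' : Fin m → ℝ} {t : ℝ}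
    (hv : HasDerivAt v v' t) (hw : HasDerivAt w w' t) :
    HasDerivAt (fun s => v s ⬝ᵥ w s) (v' ⬝ᵥ w t + v t ⬝ᵥ w') t := by
  simp only [dotProduct]
  rw [← Finset.sum_add_distrib]
  exact HasDerivAt.fun_sum fun i _ => (hasDerivAt_pi.1 hv i).mul (hasDerivAt_pi.1 hw i)

theorem energy {M : Matrix (Fin m) (Fin m) ℝ} (hM : M.PosDef) {U : (Fin m → ℝ) → ℝ}
    {g : (Fin m → ℝ) → (Fin ν → ℝ)} (hU : ∀ x, AnalyticAt ℝ U x) (hg : ∀ x, AnalyticAt ℝ g x)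
    {u v : ℝ → Fin m → ℝ} {l : Fin ν → ℝ} {h : ℝ} (hpos : 0 < h)
    (hsol : ∀ t ∈ Set.Icc (0:ℝ) h, HasDerivAt u (M⁻¹ *ᵥ v t) t ∧
                HasDerivAt v (-(grad U (u t) + gradMat g (u t) *ᵥ l)) t)
    (h0 : g (u 0) = 0) (h1 : g (u h) = 0) : Ham M U (u h) (v h) = Ham M U (u 0) (v 0) := by
  have hsym : M⁻¹ᵀ = M⁻¹ := by
    have := hM.inv.isHermitian
    simpa [Matrix.IsHermitian, Matrix.conjTranspose_eq_transpose_of_trivial] using this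
  have hder : ∀ t ∈ Set.Icc (0:ℝ) h, HasDerivAt (fun s => HamHat M U g (u s) (v s) l) 0 t := by
    intro t ht
    obtain ⟨hu, hv⟩ := hsol t ht
    have e1 := (hasDerivAt_dot hv (hasDerivAt_mulVec M⁻¹ hv)).const_mul (1 / 2 : ℝ)
    have hUd : DifferentiableAt ℝ U (u t) := (hU _).differentiableAt
    have e2 := hUd.hasFDerivAt.comp_hasDerivAt t hu
    have e3 := deriv_comp_g hg hu
    have e4 : HasDerivAt (fun s => l ⬝ᵥ g (u s)) (l ⬝ᵥ ((gradMat g (u t))ᵀ *ᵥ (M⁻¹ *ᵥ v t))) t := by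
      simpa using hasDerivAt_dot (hasDerivAt_const t l) e3
    have e5 := (e1.add e2).add e4
    refine e5.congr_deriv ?_
    rw [← grad_dot]
    generalize grad U (u t) = a
    generalize gradMat g (u t) = G
    have s1 : ∀ x y : Fin m → ℝ, x ⬝ᵥ (M⁻¹ *ᵥ y) = y ⬝ᵥ (M⁻¹ *ᵥ x) := by
      intro x y
      rw [Matrix.dotProduct_mulVec, ← Matrix.mulVec_transpose, hsym, dotProduct_comm]
    rw [s1 (v t)]
    have s2 : l ⬝ᵥ (Gᵀ *ᵥ (M⁻¹ *ᵥ v t)) = (G *ᵥ l) ⬝ᵥ (M⁻¹ *ᵥ v t) := by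
      rw [Matrix.dotProduct_mulVec, Matrix.vecMul_transpose]
    rw [s2, neg_dotProduct, add_dotProduct]
    ring
  have := norm_image_sub_le_of_norm_deriv_le_segment' (C := 0)
    (fun x hx => (hder x hx).hasDerivWithinAt) (fun x _ => by simp) h ⟨hpos.le, le_rfl⟩
  rw [zero_mul] at this
  have := sub_eq_zero.1 (norm_eq_zero.1 (le_antisymm this (norm_nonneg _)))
  simpa [HamHat, h0, h1] using this

end Concrete

theorem stmt9 {m ν : ℕ} (hmn : ν < m)
    (M : Matrix (Fin m) (Fin m) ℝ) (hM : M.PosDef)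
    (U : (Fin m → ℝ) → ℝ) (hU : ∀ x, AnalyticAt ℝ U x)
    (g : (Fin m → ℝ) → (Fin ν → ℝ)) (hg : ∀ x, AnalyticAt ℝ g x)
    (T : ℝ) (hT : 0 < T)
    (q p : ℝ → Fin m → ℝ)
    (hq : ∀ t ∈ Set.Icc (0:ℝ) T, HasDerivAt q (M⁻¹ *ᵥ p t) t)
    (hp : ∀ t ∈ Set.Icc (0:ℝ) T,
      HasDerivAt p (-(grad U (q t) + gradMat g (q t) *ᵥ lagMult M U g (q t) (p t))) t)
    (hcon : ∀ t ∈ Set.Icc (0:ℝ) T, g (q t) = 0)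
    (hns : ∀ t ∈ Set.Icc (0:ℝ) T,
      IsUnit ((gradMat g (q t))ᵀ * M⁻¹ * gradMat g (q t)))
    (tstar : ℝ) (htstar : tstar ∈ Set.Ico (0:ℝ) T)
    (K : ℝ) (hK : 0 < K) :
    ∃ h₀ > 0, ∃ r > 0, ∃ C > 0,
      ∀ h ∈ Set.Ioc (0:ℝ) h₀, tstar + h ≤ T →
        ∀ qn pn : Fin m → ℝ,
          ‖qn - q tstar‖ ≤ K * h → ‖pn - p tstar‖ ≤ K * h →
          g qn = 0 →
          IsUnit ((gradMat g qn)ᵀ * M⁻¹ * gradMat g qn) →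
          ‖(gradMat g qn)ᵀ *ᵥ (M⁻¹ *ᵥ pn)‖ ≤ K * h ^ 2 →
          (∃! lam : Fin ν → ℝ,
            ‖lam - lagMult M U g (q tstar) (p tstar)‖ ≤ r ∧
            ∃ u v : ℝ → Fin m → ℝ, u 0 = qn ∧ v 0 = pn ∧
              (∀ t ∈ Set.Icc (0:ℝ) h, HasDerivAt u (M⁻¹ *ᵥ v t) t ∧
                HasDerivAt v (-(grad U (u t) + gradMat g (u t) *ᵥ lam)) t) ∧
              g (u h) = 0) ∧
          ∀ lam : Fin ν → ℝ, ‖lam - lagMult M U g (q tstar) (p tstar)‖ ≤ r →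
            ∀ u v : ℝ → Fin m → ℝ, u 0 = qn → v 0 = pn →
              (∀ t ∈ Set.Icc (0:ℝ) h, HasDerivAt u (M⁻¹ *ᵥ v t) t ∧
                HasDerivAt v (-(grad U (u t) + gradMat g (u t) *ᵥ lam)) t) →
              g (u h) = 0 →
              Ham M U (u h) (v h) = Ham M U qn pn ∧
              ‖lam - lagMult M U g (q tstar) (p tstar)‖ ≤ C * h ∧
              ‖u h - q (tstar + h)‖ ≤ C * h ∧
              ‖v h - p (tstar + h)‖ ≤ C * h ∧
              ‖(gradMat g (u h))ᵀ *ᵥ (M⁻¹ *ᵥ v h)‖ ≤ C * h ^ 2 := by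
  have htI : tstar ∈ Set.Icc (0:ℝ) T := ⟨htstar.1, htstar.2.le⟩
  obtain ⟨L, H⟩ := coreHyp M hU hg (q tstar) (p tstar) (hns tstar htI)
  set ls := lagMult M U g (q tstar) (p tstar) with hls
  have hdet := (Matrix.isUnit_iff_isUnit_det _).1 (hns tstar htI)
  have hB1 : ∀ l, ((gradMat g (q tstar))ᵀ * M⁻¹ * gradMat g (q tstar))⁻¹ *ᵥ
      (((gradMat g (q tstar))ᵀ * M⁻¹ * gradMat g (q tstar)) *ᵥ l) = l := fun l => by
    rw [Matrix.mulVec_mulVec, Matrix.nonsing_inv_mul _ hdet, Matrix.one_mulVec]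
  have hB2 : ∀ l, ((gradMat g (q tstar))ᵀ * M⁻¹ * gradMat g (q tstar)) *ᵥ
      (((gradMat g (q tstar))ᵀ * M⁻¹ * gradMat g (q tstar))⁻¹ *ᵥ l) = l := fun l => by
    rw [Matrix.mulVec_mulVec, Matrix.mul_nonsing_inv _ hdet, Matrix.one_mulVec]
  obtain ⟨h₁, hh₁, C₁, hC₁, main⟩ := H.main (LinearMap.toContinuousLinearMap
      (Matrix.mulVecLin ((gradMat g (q tstar))ᵀ * M⁻¹ * gradMat g (q tstar))⁻¹))
    hB1 hB2 hK
  have hX := ((hq tstar htI).prodMk (hp tstar htI)).isBigO_sub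
  obtain ⟨C₂, hC₂, hX⟩ := hX.exists_pos
  rw [Asymptotics.isBigOWith_iff, Metric.eventually_nhds_iff] at hX
  obtain ⟨ε, hε, hX⟩ := hX
  refine ⟨min h₁ (ε / 2), lt_min hh₁ (by linarith), 1, one_pos, C₁ + C₂, by linarith, ?_⟩
  rintro h ⟨hpos, hle⟩ hT' qn pn hqn hpn hgn - hwn
  have hle1 := hle.trans (min_le_left _ _)
  have hle2 := hle.trans (min_le_right _ _)
  have hXh := hX (y := tstar + h) (by
    rw [Real.dist_eq, add_sub_cancel_left, abs_of_pos hpos]; linarith)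
  simp only [add_sub_cancel_left, Real.norm_of_nonneg hpos.le] at hXh
  obtain ⟨ex, uniq, est⟩ := main h ⟨hpos, hle1⟩ (qn, pn)
    (by rw [Prod.norm_def]; exact max_le hqn hpn) hgn hwn
  have mk : ∀ (l : Fin ν → ℝ) (u v : ℝ → Fin m → ℝ),
      (∀ t ∈ Set.Icc (0:ℝ) h, HasDerivAt u (M⁻¹ *ᵥ v t) t ∧
                HasDerivAt v (-(grad U (u t) + gradMat g (u t) *ᵥ l)) t) →
      ∀ t ∈ Set.Icc (0:ℝ) h, HasDerivAt (fun s => (u s, v s)) (vf M U g (u t, v t) l) t :=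
    fun l u v hs t ht => (hs t ht).1.prodMk (hs t ht).2
  refine ⟨?_, ?_⟩
  · obtain ⟨l, hl, y, hy0, hy, hz⟩ := ex
    refine ⟨l, ⟨hl, fun t => (y t).1, fun t => (y t).2, by simp [hy0], by simp [hy0],
      fun t ht => ⟨(hy t ht).fst, (hy t ht).snd⟩, hz⟩, ?_⟩
    rintro l' ⟨hl', u, v, hu0, hv0, hs, hz'⟩
    exact uniq l' l hl' hl _ y (by simp [hu0, hv0]) hy0 (mk l' u v hs) hy hz' hz
  · intro l hl u v hu0 hv0 hs hz
    obtain ⟨b1, b2, b3⟩ := est l hl (fun s => (u s, v s)) (by simp [hu0, hv0]) (mk l u v hs) hz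
    have hC1h : 0 < C₁ * h := by positivity
    have hC2h : 0 < C₂ * h := by positivity
    have hC2h2 : 0 < C₂ * h ^ 2 := by positivity
    have tri : ‖(u h, v h) - (q (tstar + h), p (tstar + h))‖ ≤ (C₁ + C₂) * h := by
      have e : (u h, v h) - (q (tstar + h), p (tstar + h)) = ((u h, v h) - (q tstar, p tstar))
        - ((q (tstar + h), p (tstar + h)) - (q tstar, p tstar)) := by abel
      rw [e]
      refine (norm_sub_le _ _).trans ?_
      linarith
    refine ⟨?_, by linarith, (norm_fst_le _).trans tri, (norm_snd_le _).trans tri, ?_⟩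
    · have := energy hM hU hg hpos hs (by rw [hu0, hgn]) hz
      rwa [hu0, hv0] at this
    · refine b3.trans ?_
      linarith
end
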